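/- arXiv:1912.08126 — 2 statements merged into one kernel-verified Lean document; each statement's English description precedes it below -/
import Mathlib

section
/- For every positive integer m, ∑_{r∈ℤ} (12/r)·s( m − (r²−1)/24 ) = 4·σ₁(m) − 2·∑_{d∣m} ( min(6d, m/d) − min(3d, 2m/d) ), where the sum over r has only finitely many nonzero terms (note that r²≡1 (mod 24) whenever gcd(r,12)=1, so all arguments of s occurring with nonzero Kronecker symbol are integers). -/
/-!
STATEMENT 4: For every positive integer m,
∑_{r∈ℤ} (12/r)·s( m − (r²−1)/24 ) = 4·σ₁(m) − 2·∑_{d∣m} ( min(6d, m/d) − min(3d, 2m/d) ),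
where s(n) = spt(n) + (1/12)(24n−1)p(n) (with s(t) = 0 if t is not a nonnegative integer),
spt is Andrews' smallest parts function, p the partition function, (12/·) the Kronecker
symbol mod 12, and the sum over r has only finitely many nonzero terms.
-/

/-- Andrews' smallest parts function: the total number of smallest parts in all partitions
of n, i.e. the sum over all partitions of n of the multiplicity of the smallest part. -/
noncomputable def spt (n : ℕ) : ℕ :=
  ∑ P : Nat.Partition n, P.parts.count (sInf {k : ℕ | k ∈ P.parts})

/-- s(n) = spt(n) + (1/12)(24n − 1)p(n), where p is the partition function. -/
noncomputable def sVal (n : ℕ) : ℝ :=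
  spt n + 1 / 12 * (24 * n - 1) * Fintype.card (Nat.Partition n)

/-- s extended to ℚ by s(t) = 0 whenever t is not a nonnegative integer. -/
noncomputable def sQ (t : ℚ) : ℝ :=
  if t.den = 1 ∧ 0 ≤ t.num then sVal t.num.toNat else 0

/-- The Kronecker symbol (12/r): 1 if r ≡ ±1 (mod 12), −1 if r ≡ ±5 (mod 12),
and 0 if gcd(r,12) > 1. -/
def kron12 (r : ℤ) : ℤ :=
  if r % 12 = 1 ∨ r % 12 = 11 then 1
  else if r % 12 = 5 ∨ r % 12 = 7 then -1
  else 0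

section

open PowerSeries

/-- The finite `q`-Pochhammer symbol `(q; q)_n` as a power series in `q = X`. -/
noncomputable def qFac (n : ℕ) : ℝ⟦X⟧ := ∏ i ∈ Finset.range n, (1 - X ^ (i + 1))

/-- The inverse of `(q; q)_n`. -/
noncomputable def qFacInv (n : ℕ) : ℝ⟦X⟧ := (qFac n)⁻¹

theorem constantCoeff_one_sub_X_pow (n : ℕ) :
    constantCoeff (1 - X ^ (n + 1) : ℝ⟦X⟧) = 1 := by
  simp

theorem one_sub_X_pow_ne_zero (n : ℕ) : (1 - X ^ (n + 1) : ℝ⟦X⟧) ≠ 0 := fun h ↦ by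
  simpa [h] using constantCoeff_one_sub_X_pow n

theorem qFac_zero : qFac 0 = 1 := by simp [qFac]

theorem qFac_succ (n : ℕ) : qFac (n + 1) = qFac n * (1 - X ^ (n + 1)) :=
  Finset.prod_range_succ _ _

theorem qFac_mul_qFacInv (n : ℕ) : qFac n * qFacInv n = 1 :=
  PowerSeries.mul_inv_cancel _ (by simp [qFac, map_prod])

theorem qFacInv_zero : qFacInv 0 = 1 := by simpa [qFac_zero] using qFac_mul_qFacInv 0

theorem qFacInv_eq (n : ℕ) : qFacInv n = qFacInv (n + 1) * (1 - X ^ (n + 1)) := by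
  linear_combination qFacInv (n + 1) * (1 - X ^ (n + 1)) * qFac_mul_qFacInv n
    - qFacInv n * qFac_mul_qFacInv (n + 1) + qFacInv n * qFacInv (n + 1) * qFac_succ n

/-- The kernel `1 / ((q; q)_{n-r} (q; q)_{n+r})` of a Bailey pair relative to `1`. -/
noncomputable def baileyKernel (n r : ℕ) : ℝ⟦X⟧ :=
  if r ≤ n then qFacInv (n - r) * qFacInv (n + r) else 0

/-- The sequence `α_0 = 1`, `α_r = (-1)^r q^{r(3r-1)/2} (1 + q^r)`. -/
noncomputable def baileyAlpha : ℕ → ℝ⟦X⟧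
  | 0 => 1
  | s + 1 => (-1) ^ (s + 1) * X ^ (3 * (s + 1).choose 2 + s + 1) * (1 + X ^ (s + 1))

theorem choose_two_succ (s : ℕ) : (s + 2).choose 2 = (s + 1).choose 2 + (s + 1) := by
  rw [Nat.choose_succ_succ' (s + 1) 1]; simp [add_comm]

/-- The telescoping certificate for `sum_baileyAlpha_mul_baileyKernel`. -/
noncomputable def alphaCertificate (n s : ℕ) : ℝ⟦X⟧ :=
  (-1) ^ s * X ^ (n + 1 + 3 * (s + 1).choose 2) * (qFacInv (n - s) * qFacInv (n + s + 1))

theorem alphaCertificate_sub (n s : ℕ) (h : s < n) :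
    (1 - X ^ (n + 1)) * (baileyAlpha (s + 1) * baileyKernel (n + 1) (s + 1))
      - baileyAlpha (s + 1) * baileyKernel n (s + 1)
      = alphaCertificate n (s + 1) - alphaCertificate n s := by
  obtain ⟨k, rfl⟩ := Nat.exists_eq_add_of_lt h
  have h1 := qFacInv_eq k
  have h2 := qFacInv_eq (2 * s + k + 2)
  rw [baileyKernel, if_pos (by omega), baileyKernel, if_pos (by omega), alphaCertificate,
    alphaCertificate, baileyAlpha, choose_two_succ]
  rw [show s + k + 1 + 1 - (s + 1) = k + 1 by omega, show s + k + 1 - (s + 1) = k by omega,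
    show s + k + 1 - s = k + 1 by omega, show s + k + 1 + 1 + (s + 1) = 2 * s + k + 2 + 1 by omega,
    show s + k + 1 + (s + 1) + 1 = 2 * s + k + 2 + 1 by omega,
    show s + k + 1 + (s + 1) = 2 * s + k + 2 by omega,
    show s + k + 1 + s + 1 = 2 * s + k + 2 by omega, h1, h2]
  ring

theorem alphaCertificate_self (n : ℕ) :
    (1 - X ^ (n + 1)) * (baileyAlpha (n + 1) * baileyKernel (n + 1) (n + 1))
      = - alphaCertificate n n := by
  have h2 := qFacInv_eq (2 * n + 1)
  rw [baileyKernel, if_pos le_rfl, alphaCertificate, baileyAlpha]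
  rw [show n + 1 + (n + 1) = 2 * n + 1 + 1 by omega, show n + n + 1 = 2 * n + 1 by omega,
    Nat.sub_self, Nat.sub_self, h2]
  ring

theorem one_sub_mul_sum_baileyAlpha (n : ℕ) :
    (1 - X ^ (n + 1)) * ∑ r ∈ Finset.range (n + 2), baileyAlpha r * baileyKernel (n + 1) r
      = ∑ r ∈ Finset.range (n + 1), baileyAlpha r * baileyKernel n r := by
  have htel : ∑ s ∈ Finset.range n,
      ((1 - X ^ (n + 1)) * (baileyAlpha (s + 1) * baileyKernel (n + 1) (s + 1))
      - baileyAlpha (s + 1) * baileyKernel n (s + 1))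
      = alphaCertificate n n - alphaCertificate n 0 := by
    rw [← Finset.sum_range_sub]
    exact Finset.sum_congr rfl fun s hs ↦ alphaCertificate_sub n s (Finset.mem_range.1 hs)
  rw [Finset.sum_sub_distrib, ← Finset.mul_sum] at htel
  rw [Finset.sum_range_succ', Finset.sum_range_succ, Finset.sum_range_succ' _ n]
  have h0 : (1 - X ^ (n + 1)) * (baileyAlpha 0 * baileyKernel (n + 1) 0)
      - baileyAlpha 0 * baileyKernel n 0 = alphaCertificate n 0 := by
    simp only [baileyAlpha, baileyKernel, alphaCertificate, if_pos (Nat.zero_le _)]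
    have h1 := qFacInv_eq n
    simp only [Nat.sub_zero, Nat.add_zero, h1]
    simp
    ring
  linear_combination htel + h0 + alphaCertificate_self n

/-- The Bailey pair relation `∑_r α_r / ((q)_{n-r} (q)_{n+r}) = 1 / (q)_n`. -/
theorem sum_baileyAlpha_mul_baileyKernel (n : ℕ) :
    ∑ r ∈ Finset.range (n + 1), baileyAlpha r * baileyKernel n r = qFacInv n := by
  induction n with
  | zero => simp [baileyAlpha, baileyKernel, qFacInv_zero]
  | succ n ih =>
    apply mul_left_cancel₀ (one_sub_X_pow_ne_zero n)
    rw [one_sub_mul_sum_baileyAlpha, ih, qFacInv_eq, mul_comm]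

/-- The summand `q^{n+1} (q)_n^2 / ((q)_{n+1-r} (q)_{n+1+r})` of the conjugate Bailey pair. -/
noncomputable def gammaTerm (n r : ℕ) : ℝ⟦X⟧ :=
  qFac n ^ 2 * X ^ (n + 1) * baileyKernel (n + 1) r

/-- The telescoping certificate for the conjugate Bailey pair. -/
noncomputable def gammaCertificate (n r : ℕ) : ℝ⟦X⟧ :=
  -((1 - X ^ (2 * r + 1)) * (1 - X ^ (n + 1 - r)) * gammaTerm n r)

theorem gammaCertificate_sub (n r : ℕ) :
    (1 - X ^ (r + 1)) ^ 2 * gammaTerm n (r + 1) - X * (1 - X ^ r) ^ 2 * gammaTerm n r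
      = gammaCertificate (n + 1) r - gammaCertificate n r := by
  rcases lt_trichotomy (n + 1) r with h | rfl | h
  · rw [gammaCertificate, gammaCertificate, gammaTerm, gammaTerm, gammaTerm, baileyKernel,
      baileyKernel, baileyKernel, if_neg (by omega), if_neg (by omega)]
    rcases Nat.lt_or_ge (n + 1 + 1) r with h' | h'
    · rw [if_neg (by omega)]; ring
    · obtain rfl : r = n + 1 + 1 := by omega
      simp
  · rw [gammaCertificate, gammaCertificate, gammaTerm, gammaTerm, gammaTerm, baileyKernel,
      baileyKernel, baileyKernel, if_neg (by omega), if_pos le_rfl, if_pos (by omega)]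
    have h1 := qFacInv_eq 0
    have h2 := qFacInv_eq (2 * n + 2)
    rw [show n + 1 + (n + 1) = 2 * n + 2 by omega,
      show n + 1 + 1 + (n + 1) = 2 * n + 2 + 1 by omega, Nat.sub_self,
      show n + 1 + 1 - (n + 1) = 0 + 1 by omega, h1, h2, qFac_succ]
    ring
  · obtain ⟨k, hk⟩ := Nat.exists_eq_add_of_lt h
    obtain rfl : n = r + k := by omega
    rw [gammaCertificate, gammaCertificate, gammaTerm, gammaTerm, gammaTerm, baileyKernel,
      baileyKernel, baileyKernel, if_pos (by omega), if_pos (by omega), if_pos (by omega)]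
    have h0 := qFacInv_eq k
    have h1 := qFacInv_eq (k + 1)
    have h2 := qFacInv_eq (2 * r + k + 1)
    rw [show r + k + 1 - (r + 1) = k by omega, show r + k + 1 - r = k + 1 by omega,
      show r + k + 1 + 1 - r = k + 1 + 1 by omega,
      show r + k + 1 + (r + 1) = 2 * r + k + 1 + 1 by omega,
      show r + k + 1 + r = 2 * r + k + 1 by omega,
      show r + k + 1 + 1 + r = 2 * r + k + 1 + 1 by omega, h0, h1, h2, qFac_succ]
    ring

theorem X_pow_dvd_gammaCertificate (n r : ℕ) : X ^ (n + 1) ∣ gammaCertificate n r :=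
  (dvd_mul_of_dvd_right (dvd_mul_of_dvd_left (dvd_mul_left _ _) _) _).neg_right

theorem gammaCertificate_zero_zero : gammaCertificate 0 0 = -X := by
  have h := qFac_mul_qFacInv 1
  rw [qFac_succ, qFac_zero] at h
  simp only [gammaCertificate, gammaTerm, baileyKernel, if_pos (Nat.zero_le _), qFac_zero]
  simp only [Nat.sub_zero, Nat.mul_zero, Nat.zero_add, Nat.add_zero] at h ⊢
  linear_combination (-X * ((1 - X ^ 1) * qFacInv 1) - X) * h

theorem gammaCertificate_zero_succ (r : ℕ) : gammaCertificate 0 (r + 1) = 0 := by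
  rcases r with _ | r
  · simp [gammaCertificate]
  · simp [gammaCertificate, gammaTerm, baileyKernel]

theorem sum_gammaTerm_recurrence (N r : ℕ) :
    (1 - X ^ (r + 1)) ^ 2 * ∑ n ∈ Finset.range N, gammaTerm n (r + 1)
      - X * (1 - X ^ r) ^ 2 * ∑ n ∈ Finset.range N, gammaTerm n r
      = gammaCertificate N r - gammaCertificate 0 r := by
  rw [Finset.mul_sum, Finset.mul_sum, ← Finset.sum_sub_distrib,
    ← Finset.sum_range_sub (gammaCertificate · r)]
  exact Finset.sum_congr rfl fun n _ ↦ gammaCertificate_sub n r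

theorem X_pow_dvd_one_sub_sq_mul_sum_gammaTerm (N r : ℕ) :
    X ^ (N + 1) ∣ (1 - X ^ (r + 1)) ^ 2 * ∑ n ∈ Finset.range N, gammaTerm n (r + 1)
      - X ^ (r + 1) := by
  induction r with
  | zero =>
    have h := sum_gammaTerm_recurrence N 0
    rw [gammaCertificate_zero_zero] at h
    convert! X_pow_dvd_gammaCertificate N 0 using 1
    linear_combination h
  | succ r ih =>
    have h := sum_gammaTerm_recurrence N (r + 1)
    rw [gammaCertificate_zero_succ] at h
    convert! (X_pow_dvd_gammaCertificate N (r + 1)).add (ih.mul_left X) using 1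
    linear_combination h

/-- The geometric series `1 / (1 - q^k)`. -/
noncomputable def geomSeries (k : ℕ) : ℝ⟦X⟧ :=
  PowerSeries.mk fun n ↦ if k ∣ n then 1 else 0

/-- The series `q^k / (1 - q^k)^2`. -/
noncomputable def lambertSeries (k : ℕ) : ℝ⟦X⟧ :=
  PowerSeries.mk fun n ↦ if k ∣ n then ((n / k : ℕ) : ℝ) else 0

theorem one_sub_mul_geomSeries (k : ℕ) : (1 - X ^ (k + 1)) * geomSeries (k + 1) = 1 := by
  ext n
  rw [sub_mul, one_mul, map_sub, coeff_X_pow_mul', coeff_one, geomSeries, coeff_mk]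
  rcases Nat.lt_or_ge n (k + 1) with h | h
  · rw [if_neg (by omega : ¬ k + 1 ≤ n)]
    have : k + 1 ∣ n ↔ n = 0 := ⟨fun hd ↦ Nat.eq_zero_of_dvd_of_lt hd h, by rintro rfl; simp⟩
    simp [this]
  · rw [if_pos h, coeff_mk, if_neg (by omega : ¬ n = 0)]
    simp [Nat.dvd_sub_iff_left h dvd_rfl]

theorem one_sub_mul_lambertSeries (k : ℕ) :
    (1 - X ^ (k + 1)) * lambertSeries (k + 1) = geomSeries (k + 1) - 1 := by
  ext n
  rw [sub_mul, one_mul, map_sub, map_sub, coeff_X_pow_mul', coeff_one, geomSeries, coeff_mk,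
    lambertSeries, coeff_mk]
  rcases Nat.lt_or_ge n (k + 1) with h | h
  · rw [if_neg (by omega : ¬ k + 1 ≤ n)]
    have : k + 1 ∣ n ↔ n = 0 := ⟨fun hd ↦ Nat.eq_zero_of_dvd_of_lt hd h, by rintro rfl; simp⟩
    rcases eq_or_ne n 0 with rfl | h0
    · simp
    · simp [this, h0]
  · rw [if_pos h, coeff_mk, if_neg (by omega : ¬ n = 0)]
    by_cases hd : k + 1 ∣ n
    · obtain ⟨c, rfl⟩ := hd
      have hc : 0 < c := by
        rcases c with _ | c
        · simp at h
        · simp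
      obtain ⟨c, rfl⟩ := Nat.exists_eq_succ_of_ne_zero hc.ne'
      rw [show (k + 1) * c.succ - (k + 1) = (k + 1) * c by rw [Nat.mul_succ]; omega]
      simp
    · simp [Nat.dvd_sub_iff_left h dvd_rfl, hd]

theorem one_sub_sq_mul_lambertSeries (k : ℕ) :
    (1 - X ^ (k + 1)) ^ 2 * lambertSeries (k + 1) = X ^ (k + 1) := by
  linear_combination (1 - X ^ (k + 1)) * one_sub_mul_lambertSeries k + one_sub_mul_geomSeries k

theorem X_pow_dvd_sum_gammaTerm_sub (N r : ℕ) :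
    X ^ (N + 1) ∣ ∑ n ∈ Finset.range N, gammaTerm n (r + 1) - lambertSeries (r + 1) := by
  convert! (X_pow_dvd_one_sub_sq_mul_sum_gammaTerm N r).mul_left (geomSeries (r + 1) ^ 2) using 1
  have h := one_sub_mul_geomSeries r
  have h' := one_sub_sq_mul_lambertSeries r
  linear_combination (-geomSeries (r + 1) ^ 2) * h' + (lambertSeries (r + 1)
    - ∑ n ∈ Finset.range N, gammaTerm n (r + 1)) * ((1 - X ^ (r + 1)) * geomSeries (r + 1) + 1) * h

theorem gammaTerm_zero (n : ℕ) : gammaTerm n 0 = lambertSeries (n + 1) := by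
  apply mul_left_cancel₀ (pow_ne_zero 2 (one_sub_X_pow_ne_zero n))
  rw [one_sub_sq_mul_lambertSeries, gammaTerm, baileyKernel, if_pos (Nat.zero_le _)]
  simp only [Nat.sub_zero, Nat.add_zero]
  have h := qFac_mul_qFacInv (n + 1)
  rw [qFac_succ] at h
  linear_combination X ^ (n + 1) * (qFac n * (1 - X ^ (n + 1)) * qFacInv (n + 1) + 1) * h

/-- Andrews' expansion of the `spt` generating function times `∏ (1 - q^i)`, modulo `q^(N+1)`. -/
theorem X_pow_dvd_sum_spt_sub (N : ℕ) :
    X ^ (N + 1) ∣ ∑ n ∈ Finset.range N, qFac n * (1 - X ^ (n + 1)) * lambertSeries (n + 1)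
      - (∑ n ∈ Finset.range N, lambertSeries (n + 1)
        + ∑ r ∈ Finset.range N, baileyAlpha (r + 1) * lambertSeries (r + 1)) := by
  have h1 : ∀ n ∈ Finset.range N, qFac n * (1 - X ^ (n + 1)) * lambertSeries (n + 1)
      = ∑ r ∈ Finset.range (N + 1), baileyAlpha r * gammaTerm n r := by
    intro n hn
    have h2 : ∑ r ∈ Finset.range (N + 1), baileyAlpha r * baileyKernel (n + 1) r
        = qFacInv (n + 1) := by
      rw [← sum_baileyAlpha_mul_baileyKernel]
      symm
      apply Finset.sum_subset
      · have := Finset.mem_range.1 hn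
        exact Finset.range_mono (by omega)
      · intro r _ hr
        rw [baileyKernel, if_neg (by simpa using hr), mul_zero]
    have h3 : ∑ r ∈ Finset.range (N + 1), baileyAlpha r * gammaTerm n r
        = qFac n ^ 2 * X ^ (n + 1) * qFacInv (n + 1) := by
      rw [← h2, Finset.mul_sum]
      exact Finset.sum_congr rfl fun r _ ↦ by rw [gammaTerm]; ring
    rw [h3]
    apply mul_left_cancel₀ (one_sub_X_pow_ne_zero n)
    have h := qFac_mul_qFacInv (n + 1)
    rw [qFac_succ] at h
    linear_combination qFac n * one_sub_sq_mul_lambertSeries n - qFac n * X ^ (n + 1) * h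
  rw [Finset.sum_congr rfl h1, Finset.sum_comm, Finset.sum_range_succ', ← Finset.mul_sum]
  simp only [← Finset.mul_sum]
  rw [Finset.sum_congr rfl fun n _ ↦ gammaTerm_zero n, baileyAlpha, one_mul,
    add_comm (∑ _ ∈ _, _ * _), add_sub_add_left_eq_sub, ← Finset.sum_sub_distrib]
  refine Finset.dvd_sum fun r _ ↦ ?_
  rw [← mul_sub]
  exact (X_pow_dvd_sum_gammaTerm_sub N r).mul_left _

open scoped PowerSeries.WithPiTopology

theorem tsum_smul_X_pow (f : ℕ → ℝ) (i : ℕ) :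
    ∑' j, f (j + 1) • (X : ℝ⟦X⟧) ^ ((i + 1) * (j + 1))
      = PowerSeries.mk fun n ↦ if n ≠ 0 ∧ i + 1 ∣ n then f (n / (i + 1)) else 0 := by
  refine HasSum.tsum_eq ?_
  set F : ℝ⟦X⟧ := PowerSeries.mk fun n ↦ if n ≠ 0 ∧ i + 1 ∣ n then f (n / (i + 1)) else 0 with hF
  have hinj : Function.Injective fun j : ℕ ↦ (i + 1) * (j + 1) := fun a b h ↦ by
    simpa using h
  have h := (hinj.hasSum_iff (f := fun n ↦ monomial n (coeff n F)) (a := F) ?_).2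
    (PowerSeries.hasSum_of_monomials_self F)
  · convert! h using 2 with j
    simp [hF, monomial_eq_C_mul_X_pow, smul_eq_C_mul]
  · intro n hn
    rw [hF, coeff_mk, if_neg, map_zero]
    rintro ⟨h0, c, rfl⟩
    rcases c with _ | c
    · simp at h0
    · exact hn ⟨c, rfl⟩

theorem one_add_tsum_X_pow (i : ℕ) :
    1 + ∑' j, (1 : ℝ) • (X : ℝ⟦X⟧) ^ ((i + 1) * (j + 1)) = geomSeries (i + 1) := by
  rw [tsum_smul_X_pow (fun _ ↦ 1)]
  ext n
  rw [map_add, coeff_one, coeff_mk, geomSeries, coeff_mk]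
  rcases eq_or_ne n 0 with rfl | h <;> simp [*]

theorem genFun_mul_pentagonalSeries (f : ℕ → ℕ → ℝ) (k : ℕ)
    (hf : ∀ i c, k < i → f i c = 1) :
    Nat.Partition.genFun f * pentagonalSeries ℝ = ∏ i ∈ Finset.range k,
      ((1 + ∑' j, f (i + 1) (j + 1) • X ^ ((i + 1) * (j + 1))) * (1 - X ^ (i + 1))) := by
  have h1 := (Nat.Partition.hasProd_genFun f).mul (WithPiTopology.hasProd_one_sub_X_pow ℝ)
  refine h1.unique (hasProd_prod_of_ne_finset_one fun i hi ↦ ?_)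
  have hi' : k < i + 1 := by simpa [Nat.lt_succ_iff] using hi
  simp only [hf _ _ hi', one_add_tsum_X_pow]
  rw [mul_comm, one_sub_mul_geomSeries]

theorem tsum_natCast_smul_X_pow (i : ℕ) :
    ∑' j : ℕ, ((j + 1 : ℕ) : ℝ) • (X : ℝ⟦X⟧) ^ ((i + 1) * (j + 1)) = lambertSeries (i + 1) := by
  rw [tsum_smul_X_pow (fun c ↦ (c : ℝ))]
  ext n
  rw [coeff_mk, lambertSeries, coeff_mk]
  rcases eq_or_ne n 0 with rfl | h <;> simp [*]

/-- The weight on parts that is `a` on parts smaller than `k`, is `1` on parts larger than `k`,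
and depends on the multiplicity of `k` through `b`. -/
def partWeight (k : ℕ) (a : ℝ) (b : ℕ → ℝ) (i c : ℕ) : ℝ :=
  if i < k then a else if i = k then b c else 1

/-- The generating function of partitions weighted by the multiplicity of `k`,
and by `a` for each distinct part smaller than `k`. -/
noncomputable def countSeries (k : ℕ) (a : ℝ) : ℝ⟦X⟧ :=
  Nat.Partition.genFun (partWeight k a fun c ↦ c) - Nat.Partition.genFun (partWeight k a 0)

theorem genFun_partWeight_mul_pentagonalSeries (k : ℕ) (a : ℝ) (b : ℕ → ℝ) :
    Nat.Partition.genFun (partWeight (k + 1) a b) * pentagonalSeries ℝ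
      = (∏ i ∈ Finset.range k,
          ((1 + ∑' j, a • X ^ ((i + 1) * (j + 1))) * (1 - X ^ (i + 1))))
        * ((1 + ∑' j, b (j + 1) • X ^ ((k + 1) * (j + 1))) * (1 - X ^ (k + 1))) := by
  rw [genFun_mul_pentagonalSeries _ (k + 1), Finset.prod_range_succ]
  · congr 1
    · refine Finset.prod_congr rfl fun i hi ↦ ?_
      simp [partWeight, Finset.mem_range.1 hi]
    · simp [partWeight]
  · intro i c h
    rw [partWeight, if_neg (by omega), if_neg (by omega)]

theorem countSeries_mul_pentagonalSeries (k : ℕ) (a : ℝ) :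
    countSeries (k + 1) a * pentagonalSeries ℝ
      = (∏ i ∈ Finset.range k,
          ((1 + ∑' j, a • X ^ ((i + 1) * (j + 1))) * (1 - X ^ (i + 1))))
        * ((1 - X ^ (k + 1)) * lambertSeries (k + 1)) := by
  rw [countSeries, sub_mul, genFun_partWeight_mul_pentagonalSeries,
    genFun_partWeight_mul_pentagonalSeries, tsum_natCast_smul_X_pow]
  simp
  ring

theorem countSeries_zero_mul_pentagonalSeries (k : ℕ) :
    countSeries (k + 1) 0 * pentagonalSeries ℝ
      = qFac k * (1 - X ^ (k + 1)) * lambertSeries (k + 1) := by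
  rw [countSeries_mul_pentagonalSeries, qFac, mul_assoc]
  simp

theorem countSeries_one_mul_pentagonalSeries (k : ℕ) :
    countSeries (k + 1) 1 * pentagonalSeries ℝ = geomSeries (k + 1) - 1 := by
  rw [countSeries_mul_pentagonalSeries, one_sub_mul_lambertSeries, Finset.prod_eq_one, one_mul]
  intro i _
  rw [one_add_tsum_X_pow, mul_comm, one_sub_mul_geomSeries]

theorem prod_partWeight_sub (s : Multiset ℕ) (k : ℕ) (a : ℝ) :
    (Multiset.toFinsupp s).prod (partWeight k a fun c ↦ c)
      - (Multiset.toFinsupp s).prod (partWeight k a 0)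
      = s.count k * ∏ i ∈ s.toFinset.erase k, if i < k then a else 1 := by
  have hprod : ∀ b : ℕ → ℝ, ∏ i ∈ s.toFinset.erase k, partWeight k a b i (s.count i)
      = ∏ i ∈ s.toFinset.erase k, if i < k then a else 1 := fun b ↦
    Finset.prod_congr rfl fun i hi ↦ by rw [partWeight, if_neg (Finset.ne_of_mem_erase hi)]
  simp only [Finsupp.prod, Multiset.toFinsupp_support, Multiset.toFinsupp_apply]
  by_cases h : k ∈ s
  · have h' : k ∈ s.toFinset := Multiset.mem_toFinset.2 h
    rw [← Finset.mul_prod_erase _ _ h', ← Finset.mul_prod_erase _ _ h', hprod, hprod]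
    simp [partWeight]
  · rw [← Finset.erase_eq_of_notMem (mt Multiset.mem_toFinset.1 h), hprod, hprod,
      Multiset.count_eq_zero_of_notMem h]
    simp

theorem coeff_countSeries (k : ℕ) (a : ℝ) (n : ℕ) :
    coeff n (countSeries k a) = ∑ P : Nat.Partition n,
      P.parts.count k * ∏ i ∈ P.parts.toFinset.erase k, if i < k then a else 1 := by
  rw [countSeries, map_sub, Nat.Partition.coeff_genFun, Nat.Partition.coeff_genFun,
    ← Finset.sum_sub_distrib]
  exact Finset.sum_congr rfl fun P _ ↦ prod_partWeight_sub _ _ _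

theorem sum_coeff_countSeries_zero {n N : ℕ} (h : n ≤ N) :
    ∑ k ∈ Finset.range N, coeff n (countSeries (k + 1) 0) = spt n := by
  simp only [coeff_countSeries, spt, Nat.cast_sum]
  rw [Finset.sum_comm]
  refine Finset.sum_congr rfl fun P _ ↦ ?_
  rcases Set.eq_empty_or_nonempty {k : ℕ | k ∈ P.parts} with h0 | h0
  · have h1 : ∀ k, P.parts.count k = 0 := fun k ↦
      Multiset.count_eq_zero_of_notMem fun hk ↦ (h0.le hk : k ∈ (∅ : Set ℕ))
    simp [h1]
  · have hmem : sInf {k : ℕ | k ∈ P.parts} ∈ P.parts := Nat.sInf_mem h0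
    have hmin : ∀ i ∈ P.parts, sInf {k : ℕ | k ∈ P.parts} ≤ i := fun i hi ↦ Nat.sInf_le hi
    obtain ⟨j, hj⟩ := Nat.exists_eq_succ_of_ne_zero (P.parts_pos hmem).ne'
    have hjn : j + 1 ≤ n := by have := P.le_of_mem_parts hmem; omega
    rw [hj] at hmem hmin ⊢
    rw [Finset.sum_eq_single j]
    · rw [Finset.prod_eq_one, mul_one]
      intro i hi
      rw [if_neg (not_lt.2 (hmin i (by simpa using Finset.mem_of_mem_erase hi)))]
    · intro k _ hk
      by_cases hkP : k + 1 ∈ P.parts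
      · have := hmin _ hkP
        rw [Finset.prod_eq_zero (i := j + 1), mul_zero]
        · simpa using ⟨hk.symm, hmem⟩
        · rw [if_pos (by omega)]
      · rw [Multiset.count_eq_zero_of_notMem hkP, Nat.cast_zero, zero_mul]
    · intro hjN
      exact absurd (Finset.mem_range.2 (by omega)) hjN

theorem sum_coeff_countSeries_one {n N : ℕ} (h : n ≤ N) :
    ∑ k ∈ Finset.range N, ((k + 1 : ℕ) : ℝ) * coeff n (countSeries (k + 1) 1)
      = n * Fintype.card (Nat.Partition n) := by
  simp only [coeff_countSeries, Finset.mul_sum]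
  rw [Finset.sum_comm]
  have : ∀ P : Nat.Partition n, ∑ k ∈ Finset.range N, ((k + 1 : ℕ) : ℝ) *
      (P.parts.count (k + 1) * ∏ i ∈ P.parts.toFinset.erase (k + 1),
        if i < k + 1 then (1 : ℝ) else 1) = n := by
    intro P
    have h1 : P.parts.sum = ∑ i ∈ Finset.range (N + 1), P.parts.count i * i := by
      rw [Finset.sum_multiset_count]
      simp only [smul_eq_mul]
      apply Finset.sum_subset
      · intro i hi
        have := P.le_of_mem_parts (Multiset.mem_toFinset.1 hi)
        exact Finset.mem_range.2 (by omega)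
      · intro i _ hi
        rw [Multiset.count_eq_zero_of_notMem (by simpa using hi), zero_mul]
    rw [P.parts_sum, Finset.sum_range_succ'] at h1
    conv_rhs => rw [h1]
    simp [mul_comm]
  rw [Finset.sum_congr rfl fun P _ ↦ this P]
  simp [mul_comm]

theorem genFun_one_mul_pentagonalSeries :
    Nat.Partition.genFun (fun _ _ ↦ (1 : ℝ)) * pentagonalSeries ℝ = 1 := by
  simpa using genFun_mul_pentagonalSeries _ 0 fun _ _ _ ↦ rfl

/-- The generating function of `sVal`. -/
noncomputable def sSeries : ℝ⟦X⟧ := PowerSeries.mk sVal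

theorem X_pow_dvd_sSeries_sub (N : ℕ) :
    X ^ (N + 1) ∣ sSeries - (∑ k ∈ Finset.range N, countSeries (k + 1) 0
      + C 2 * ∑ k ∈ Finset.range N, C ((k + 1 : ℕ) : ℝ) * countSeries (k + 1) 1
      - C (1 / 12) * Nat.Partition.genFun (fun _ _ ↦ (1 : ℝ))) := by
  rw [X_pow_dvd_iff]
  intro n hn
  simp only [map_sub, map_add, coeff_C_mul, map_sum,
    sum_coeff_countSeries_zero (Nat.le_of_lt_succ hn),
    sum_coeff_countSeries_one (Nat.le_of_lt_succ hn), sSeries, coeff_mk, sVal,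
    Nat.Partition.coeff_genFun]
  simp [Finsupp.prod]
  ring

theorem X_pow_dvd_sSeries_mul_pentagonalSeries_sub (N : ℕ) :
    X ^ (N + 1) ∣ sSeries * pentagonalSeries ℝ - (∑ n ∈ Finset.range N, lambertSeries (n + 1)
        + ∑ r ∈ Finset.range N, baileyAlpha (r + 1) * lambertSeries (r + 1)
        + C 2 * ∑ k ∈ Finset.range N, C ((k + 1 : ℕ) : ℝ) * (geomSeries (k + 1) - 1)
        - C (1 / 12)) := by
  convert! ((X_pow_dvd_sSeries_sub N).mul_right (pentagonalSeries ℝ)).add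
    (X_pow_dvd_sum_spt_sub N) using 1
  simp only [← countSeries_zero_mul_pentagonalSeries, ← countSeries_one_mul_pentagonalSeries,
    ← Finset.sum_mul, ← mul_assoc]
  linear_combination (-C (1 / 12)) * genFun_one_mul_pentagonalSeries

theorem coeff_one_add_mul_lambertSeries (k n : ℕ) :
    coeff n ((1 + X ^ (k + 1)) * lambertSeries (k + 1))
      = if n ≠ 0 ∧ k + 1 ∣ n then 2 * ((n / (k + 1) : ℕ) : ℝ) - 1 else 0 := by
  have h : (1 + X ^ (k + 1)) * lambertSeries (k + 1)
      = C 2 * lambertSeries (k + 1) - (geomSeries (k + 1) - 1) := by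
    rw [← one_sub_mul_lambertSeries, map_ofNat]
    ring
  rw [h, map_sub, map_sub, coeff_C_mul, lambertSeries, geomSeries, coeff_mk, coeff_mk, coeff_one]
  rcases eq_or_ne n 0 with rfl | h0
  · simp
  · by_cases hd : k + 1 ∣ n <;> simp [h0, hd]

theorem two_mul_alpha_exponent (s : ℕ) :
    2 * (3 * (s + 1).choose 2 + s + 1) = (s + 1) * (3 * s + 2) := by
  induction s with
  | zero => simp
  | succ s ih => rw [choose_two_succ]; linarith

theorem coeff_baileyAlpha_mul_lambertSeries (m s : ℕ) :
    coeff m (baileyAlpha (s + 1) * lambertSeries (s + 1))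
      = (-1) ^ (s + 1) * if 3 * (s + 1).choose 2 + s + 1 < m ∧
          s + 1 ∣ m - (3 * (s + 1).choose 2 + s + 1)
        then 2 * (((m - (3 * (s + 1).choose 2 + s + 1)) / (s + 1) : ℕ) : ℝ) - 1 else 0 := by
  have h : baileyAlpha (s + 1) * lambertSeries (s + 1) = C ((-1) ^ (s + 1))
      * (X ^ (3 * (s + 1).choose 2 + s + 1) * ((1 + X ^ (s + 1)) * lambertSeries (s + 1))) := by
    rw [baileyAlpha]
    simp only [map_pow, map_neg, map_one]
    ring
  rw [h, coeff_C_mul, coeff_X_pow_mul', coeff_one_add_mul_lambertSeries]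
  congr 1
  generalize 3 * (s + 1).choose 2 + s + 1 = e
  rcases Nat.lt_or_ge e m with h | h
  · simp [h.le, h, (Nat.sub_pos_of_lt h).ne']
  · simp [Nat.not_lt.2 h, Nat.sub_eq_zero_of_le h]

theorem coeff_baileyAlpha_of_eq {m s i : ℕ} (h : 2 * m = (s + 1) * (3 * (s + 1) + 1 + 2 * i)) :
    coeff m (baileyAlpha (s + 1) * lambertSeries (s + 1)) = (-1) ^ (s + 1) * (2 * i + 1) := by
  have he := two_mul_alpha_exponent s
  have hm : m = 3 * (s + 1).choose 2 + s + 1 + (s + 1) * (i + 1) := by nlinarith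
  rw [coeff_baileyAlpha_mul_lambertSeries]
  generalize 3 * (s + 1).choose 2 + s + 1 = e at hm
  subst hm
  rw [Nat.add_sub_cancel_left, if_pos ⟨by simp, Nat.dvd_mul_right _ _⟩,
    Nat.mul_div_cancel_left _ (Nat.succ_pos s)]
  push_cast
  ring

theorem coeff_baileyAlpha_of_ne {m s : ℕ}
    (h : ∀ i, 2 * m ≠ (s + 1) * (3 * (s + 1) + 1 + 2 * i)) :
    coeff m (baileyAlpha (s + 1) * lambertSeries (s + 1)) = 0 := by
  have he := two_mul_alpha_exponent s
  rw [coeff_baileyAlpha_mul_lambertSeries, if_neg, mul_zero]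
  generalize 3 * (s + 1).choose 2 + s + 1 = e at he
  rintro ⟨h1, c, hc⟩
  rcases c with _ | c
  · omega
  · refine h c ?_
    have : m = e + (s + 1) * (c + 1) := by omega
    rw [this, mul_add, he]
    ring

theorem coeff_baileyAlpha_eq_divisor_indicator (m s : ℕ) (hm : 0 < m) :
    coeff m (baileyAlpha (s + 1) * lambertSeries (s + 1))
      = (if Even (s + 1) ∧ s + 1 ∣ 2 * m
          then ((2 * m / (s + 1) - 3 * (s + 1) : ℕ) : ℝ) else 0)
        - if s + 1 ∣ m then ((2 * m / (s + 1) - 3 * (s + 1) : ℕ) : ℝ) else 0 := by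
  by_cases hd : s + 1 ∣ 2 * m
  · obtain ⟨e, he⟩ := hd
    rw [he, Nat.mul_div_cancel_left _ (Nat.succ_pos s)]
    have hdvd : s + 1 ∣ m ↔ Even e := by
      constructor
      · rintro ⟨c, rfl⟩
        refine ⟨c, Nat.eq_of_mul_eq_mul_left (Nat.succ_pos s) ?_⟩
        linarith
      · rintro ⟨c, rfl⟩
        exact ⟨c, by linarith⟩
    have hodd : Even (s + 1) ∨ Even e := by
      rw [← Nat.even_mul, ← he]
      exact even_two_mul m
    by_cases hi : ∃ i, e = 3 * (s + 1) + 1 + 2 * i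
    · obtain ⟨i, rfl⟩ := hi
      rw [coeff_baileyAlpha_of_eq he]
      have hsub : 3 * (s + 1) + 1 + 2 * i - 3 * (s + 1) = 2 * i + 1 := by omega
      rw [hsub]
      by_cases hs : Even (s + 1)
      · have hne : ¬ s + 1 ∣ m := by rw [hdvd]; grind
        rw [if_pos ⟨hs, Nat.dvd_mul_right _ _⟩, if_neg hne, hs.neg_one_pow]
        push_cast
        ring
      · have hdm : s + 1 ∣ m := by rw [hdvd]; tauto
        rw [if_neg fun h ↦ hs h.1, if_pos hdm, (Nat.not_even_iff_odd.1 hs).neg_one_pow]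
        push_cast
        ring
    · rw [coeff_baileyAlpha_of_ne fun i h ↦
        hi ⟨i, Nat.eq_of_mul_eq_mul_left (Nat.succ_pos s) (he.symm.trans h)⟩]
      rcases Nat.le_total e (3 * (s + 1)) with hle | hle
      · simp [Nat.sub_eq_zero_of_le hle]
      · have hpar : Even (e - 3 * (s + 1)) := by
          by_contra hne
          obtain ⟨i, hi'⟩ := Nat.not_even_iff_odd.1 hne
          exact hi ⟨i, by omega⟩
        have hboth : Even (s + 1) ∧ Even e := by grind
        rw [if_pos ⟨hboth.1, Nat.dvd_mul_right _ _⟩, if_pos (hdvd.2 hboth.2), sub_self]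
  · rw [if_neg fun h ↦ hd h.2, if_neg fun h ↦ hd (h.mul_left 2), sub_zero,
      coeff_baileyAlpha_of_ne fun i h ↦ hd ⟨_, h⟩]

theorem sum_range_dvd_eq_sum_divisors {m N : ℕ} (hm : 0 < m) (hN : m ≤ N) (f : ℕ → ℝ) :
    ∑ k ∈ Finset.range N, (if k + 1 ∣ m then f (k + 1) else 0) = ∑ d ∈ m.divisors, f d := by
  rw [← Finset.sum_filter]
  refine Finset.sum_bij (fun k _ ↦ k + 1) ?_ ?_ ?_ fun _ _ ↦ rfl
  · intro k hk
    exact Nat.mem_divisors.2 ⟨(Finset.mem_filter.1 hk).2, hm.ne'⟩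
  · intro a _ b _ h
    simpa using h
  · intro b hb
    have h0 := Nat.pos_of_mem_divisors hb
    have hd := Nat.dvd_of_mem_divisors hb
    have hle := Nat.le_of_dvd hm hd
    have hb1 : b - 1 + 1 = b := Nat.sub_add_cancel h0
    exact ⟨b - 1, Finset.mem_filter.2 ⟨Finset.mem_range.2 (by omega), by rwa [hb1]⟩, hb1⟩

theorem sum_even_divisors {m : ℕ} (hm : 0 < m) (f : ℕ → ℝ) :
    ∑ d ∈ (2 * m).divisors, (if Even d then f d else 0) = ∑ d ∈ m.divisors, f (2 * d) := by
  rw [← Finset.sum_filter]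
  symm
  refine Finset.sum_bij (fun d _ ↦ 2 * d) ?_ ?_ ?_ fun _ _ ↦ rfl
  · intro d hd
    simp only [Finset.mem_filter, Nat.mem_divisors] at hd ⊢
    exact ⟨⟨Nat.mul_dvd_mul_left 2 hd.1, by omega⟩, even_two_mul d⟩
  · intro a _ b _ h
    simpa using h
  · intro b hb
    simp only [Finset.mem_filter, Nat.mem_divisors] at hb
    obtain ⟨c, rfl⟩ := even_iff_two_dvd.1 hb.2
    exact ⟨c, by simpa using ⟨Nat.dvd_of_mul_dvd_mul_left two_pos hb.1.1, hm.ne'⟩, rfl⟩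

theorem sum_coeff_baileyAlpha {m : ℕ} (hm : 0 < m) :
    ∑ s ∈ Finset.range (2 * m), coeff m (baileyAlpha (s + 1) * lambertSeries (s + 1))
      = -∑ d ∈ m.divisors, (d : ℝ) - ∑ d ∈ m.divisors,
        (((min (6 * d) (m / d) : ℕ) : ℝ) - ((min (3 * d) (2 * m / d) : ℕ) : ℝ)) := by
  simp only [coeff_baileyAlpha_eq_divisor_indicator _ _ hm, Finset.sum_sub_distrib]
  rw [sum_range_dvd_eq_sum_divisors hm (by omega) fun r ↦ ((2 * m / r - 3 * r : ℕ) : ℝ)]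
  have h1 : ∑ k ∈ Finset.range (2 * m), (if Even (k + 1) ∧ k + 1 ∣ 2 * m
      then ((2 * m / (k + 1) - 3 * (k + 1) : ℕ) : ℝ) else 0)
      = ∑ d ∈ m.divisors, ((2 * m / (2 * d) - 3 * (2 * d) : ℕ) : ℝ) := by
    rw [← sum_even_divisors hm fun r ↦ ((2 * m / r - 3 * r : ℕ) : ℝ),
      ← sum_range_dvd_eq_sum_divisors (by omega) le_rfl]
    refine Finset.sum_congr rfl fun k _ ↦ ?_
    by_cases h : k + 1 ∣ 2 * m <;> simp [h]
  rw [h1, ← Nat.sum_div_divisors m fun d ↦ (d : ℝ), ← Finset.sum_sub_distrib,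
    ← Finset.sum_sub_distrib, ← Finset.sum_neg_distrib, ← Finset.sum_sub_distrib]
  refine Finset.sum_congr rfl fun d hd ↦ ?_
  obtain ⟨c, rfl⟩ := Nat.dvd_of_mem_divisors hd
  have hd0 : 0 < d := Nat.pos_of_mem_divisors hd
  have e1 : d * c / d = c := Nat.mul_div_cancel_left c hd0
  have e2 : 2 * (d * c) / d = 2 * c := by
    rw [mul_left_comm]; exact Nat.mul_div_cancel_left _ hd0
  have e3 : 2 * (d * c) / (2 * d) = c := by
    rw [← mul_assoc]; exact Nat.mul_div_cancel_left _ (by omega)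
  rw [e1, e2, e3]
  have e4 : ((c - 3 * (2 * d) : ℕ) : ℝ) + (min (6 * d) c : ℕ) = c := by
    exact_mod_cast (by omega : c - 3 * (2 * d) + min (6 * d) c = c)
  have e5 : ((2 * c - 3 * d : ℕ) : ℝ) + (min (3 * d) (2 * c) : ℕ) = 2 * c := by
    exact_mod_cast (by omega : 2 * c - 3 * d + min (3 * d) (2 * c) = 2 * c)
  linear_combination e4 - e5

theorem coeff_sSeries_mul_pentagonalSeries {m : ℕ} (hm : 0 < m) :
    coeff m (sSeries * pentagonalSeries ℝ) = 2 * ∑ d ∈ m.divisors, (d : ℝ)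
      - ∑ d ∈ m.divisors,
        (((min (6 * d) (m / d) : ℕ) : ℝ) - ((min (3 * d) (2 * m / d) : ℕ) : ℝ)) := by
  have h := X_pow_dvd_iff.1 (X_pow_dvd_sSeries_mul_pentagonalSeries_sub (2 * m)) m (by omega)
  rw [map_sub, sub_eq_zero] at h
  rw [h]
  rw [map_sub, map_add, map_add, map_sum, map_sum, sum_coeff_baileyAlpha hm]
  simp only [map_sum, coeff_C_mul, map_sub, coeff_one, coeff_C, if_neg hm.ne', lambertSeries,
    geomSeries, coeff_mk, sub_zero, mul_ite, mul_one, mul_zero]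
  rw [sum_range_dvd_eq_sum_divisors hm (by omega) fun r ↦ ((m / r : ℕ) : ℝ),
    sum_range_dvd_eq_sum_divisors hm (by omega) fun r ↦ (r : ℝ),
    Nat.sum_div_divisors m fun d ↦ (d : ℝ)]
  ring

theorem sQ_natCast_sub (m a : ℕ) :
    sQ ((m : ℚ) - a) = if a ≤ m then sVal (m - a) else 0 := by
  have h : ((m : ℚ) - a) = ((m - a : ℤ) : ℚ) := by push_cast; ring
  rw [sQ, h, Rat.den_intCast, Rat.num_intCast]
  by_cases ham : a ≤ m
  · rw [if_pos ⟨rfl, by omega⟩, if_pos ham]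
    congr 1
    omega
  · rw [if_neg (by omega), if_neg ham]

theorem kron12_six_mul_add_one (j : ℤ) : kron12 (6 * j + 1) = (Int.negOnePow j : ℤ) := by
  rcases Int.even_or_odd j with h | h
  · rw [Int.negOnePow_even _ h, kron12, if_pos (by grind)]; rfl
  · rw [Int.negOnePow_odd _ h, kron12, if_neg (by grind), if_pos (by grind)]; rfl

theorem kron12_neg (r : ℤ) : kron12 (-r) = kron12 r := by
  rw [kron12, kron12]
  congr 1
  · grind
  · congr 1
    grind

/-- The summand `(12/r) s(m - (r² - 1) / 24)`. -/
noncomputable def kronSummand (m : ℕ) (r : ℤ) : ℝ :=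
  (kron12 r : ℝ) * sQ ((m : ℚ) - ((r : ℚ) ^ 2 - 1) / 24)

theorem kronSummand_neg (m : ℕ) (r : ℤ) : kronSummand m (-r) = kronSummand m r := by
  simp [kronSummand, kron12_neg]

/-- The summand at a pentagonal number `a` of the `m`-th coefficient of the product. -/
noncomputable def pentagonalSummand (m a : ℕ) : ℝ :=
  coeff a (pentagonalSeries ℝ) * if a ≤ m then sVal (m - a) else 0

theorem kronSummand_six_mul_add_one (m : ℕ) (j : ℤ) :
    kronSummand m (6 * j + 1) = pentagonalSummand m (pentagonal (-j)) := by
  have h : (((6 * j + 1 : ℤ) : ℚ) ^ 2 - 1) / 24 = (pentagonal (-j) : ℕ) := by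
    have := two_mul_natCast_pentagonal_neg j
    have h' : (2 : ℚ) * (pentagonal (-j) : ℕ) = j * (3 * j + 1) := by exact_mod_cast this
    push_cast
    linear_combination (-1 / 2 : ℚ) * h'
  rw [kronSummand, h, sQ_natCast_sub, kron12_six_mul_add_one, pentagonalSummand,
    coeff_pentagonalSeries_pentagonal]
  simp

theorem support_kronSummand_finite (m : ℕ) : (Function.support (kronSummand m)).Finite := by
  refine (Set.finite_Icc (-(24 * m + 1) : ℤ) (24 * m + 1)).subset fun r hr ↦ ?_
  by_contra hmem
  refine hr ?_
  have hr2 : (24 * m + 1 : ℤ) < r ^ 2 := by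
    rw [Set.mem_Icc, not_and_or, not_le, not_le] at hmem
    rcases hmem with h | h <;> nlinarith
  have hr2' : (24 * m + 1 : ℚ) < (r : ℚ) ^ 2 := by exact_mod_cast hr2
  rw [kronSummand, sQ, if_neg, mul_zero]
  rintro ⟨-, h⟩
  rw [Rat.num_nonneg] at h
  linarith

theorem finsum_kronSummand (m : ℕ) :
    ∑ᶠ r, kronSummand m r = 2 * ∑ᶠ j : ℤ, pentagonalSummand m (pentagonal (-j)) := by
  have hfin := support_kronSummand_finite m
  have h1 : ∑ᶠ r, kronSummand m r = ∑ᶠ r ∈ Set.range (fun j : ℤ ↦ 6 * j + 1) ∪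
      Set.range (fun j : ℤ ↦ -(6 * j + 1)), kronSummand m r := by
    rw [← finsum_mem_univ]
    refine finsum_mem_inter_support_eq' _ _ _ fun r hr ↦ ⟨fun _ ↦ ?_, fun _ ↦ trivial⟩
    by_contra hmem
    refine hr ?_
    have hk : kron12 r = 0 := by
      have h5 : r % 6 ≠ 1 := fun h ↦ hmem (Or.inl ⟨r / 6, by dsimp only; omega⟩)
      have h7 : r % 6 ≠ 5 := fun h ↦ hmem (Or.inr ⟨-(r / 6 + 1), by dsimp only; omega⟩)
      rw [kron12, if_neg (by omega), if_neg (by omega)]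
    simp [kronSummand, hk]
  rw [h1, finsum_mem_union' _ (hfin.inter_of_right _) (hfin.inter_of_right _),
    finsum_mem_range fun a b h ↦ by simpa using h,
    finsum_mem_range fun a b h ↦ by simpa using h]
  · simp only [kronSummand_neg, kronSummand_six_mul_add_one]
    ring
  · rw [Set.disjoint_left]
    rintro _ ⟨a, rfl⟩ ⟨b, hb⟩
    dsimp only at hb
    omega

theorem finsum_pentagonalSummand (m : ℕ) :
    ∑ᶠ j : ℤ, pentagonalSummand m (pentagonal (-j)) = coeff m (sSeries * pentagonalSeries ℝ) := by
  have hinj : Function.Injective fun j : ℤ ↦ pentagonal (-j) :=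
    pentagonal_injective.comp neg_injective
  rw [← finsum_mem_range (f := pentagonalSummand m) hinj]
  have h1 : ∑ᶠ a ∈ Set.range (fun j : ℤ ↦ pentagonal (-j)), pentagonalSummand m a
      = ∑ᶠ a, pentagonalSummand m a := by
    rw [← finsum_mem_univ (pentagonalSummand m)]
    refine finsum_mem_inter_support_eq' _ _ _ fun a ha ↦ ⟨fun _ ↦ trivial, fun _ ↦ ?_⟩
    by_contra hmem
    refine ha ?_
    rw [pentagonalSummand, (coeff_pentagonalSeries_eq_zero ℝ ?_), zero_mul]
    rintro ⟨k, rfl⟩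
    exact hmem ⟨-k, by simp⟩
  rw [h1, finsum_eq_sum_of_support_subset (s := Finset.range (m + 1)), mul_comm, coeff_mul,
    Finset.Nat.sum_antidiagonal_eq_sum_range_succ
      fun a b ↦ coeff a (pentagonalSeries ℝ) * coeff b sSeries]
  · refine Finset.sum_congr rfl fun a ha ↦ ?_
    rw [pentagonalSummand, if_pos (Nat.le_of_lt_succ (Finset.mem_range.1 ha)), sSeries, coeff_mk]
  · intro a ha
    by_contra hmem
    refine ha ?_
    rw [pentagonalSummand, if_neg (by simpa using hmem), mul_zero]

end

theorem statement4 (m : ℕ) (hm : 0 < m) :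
    {r : ℤ | (kron12 r : ℝ) * sQ ((m : ℚ) - ((r : ℚ) ^ 2 - 1) / 24) ≠ 0}.Finite ∧
    ∑ᶠ r : ℤ, (kron12 r : ℝ) * sQ ((m : ℚ) - ((r : ℚ) ^ 2 - 1) / 24)
      = 4 * (∑ d ∈ m.divisors, (d : ℝ))
        - 2 * ∑ d ∈ m.divisors,
            (((min (6 * d) (m / d) : ℕ) : ℝ) - ((min (3 * d) (2 * m / d) : ℕ) : ℝ)) := by
  refine ⟨support_kronSummand_finite m, ?_⟩
  refine (finsum_kronSummand m).trans ?_
  rw [finsum_pentagonalSummand, coeff_sSeries_mul_pentagonalSeries hm]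
  ring
end

section
/- For every positive integer m, ∑_{r∈ℤ} H(4m−r²) = 2·σ₁(m) − ∑_{a,b∈ℕ, ab=m} min(a,b), where the sum over r has only finitely many nonzero terms. -/
/-!
STATEMENT 5: the Hurwitz–Kronecker class number relation: for every positive integer m,
∑_{r∈ℤ} H(4m−r²) = 2·σ₁(m) − ∑_{a,b∈ℕ, ab=m} min(a,b),
where the sum over r has only finitely many nonzero terms.
-/

/-- Integral binary quadratic forms [a,b,c] are represented as triples (a,b,c) ∈ ℤ³,
with Q(x,y) = ax² + bxy + cy² and discriminant b² − 4ac. -/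
def qfAct (g : Matrix.SpecialLinearGroup (Fin 2) ℤ) (Q : ℤ × ℤ × ℤ) : ℤ × ℤ × ℤ :=
  ((Q.1 * (g.1 0 0) ^ 2 + Q.2.1 * (g.1 0 0) * (g.1 0 1) + Q.2.2 * (g.1 0 1) ^ 2),
   (2 * Q.1 * (g.1 0 0) * (g.1 1 0) + Q.2.1 * ((g.1 0 0) * (g.1 1 1) + (g.1 0 1) * (g.1 1 0)) +
      2 * Q.2.2 * (g.1 0 1) * (g.1 1 1)),
   (Q.1 * (g.1 1 0) ^ 2 + Q.2.1 * (g.1 1 0) * (g.1 1 1) + Q.2.2 * (g.1 1 1) ^ 2))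

/-- SL₂(ℤ)-equivalence of integral binary quadratic forms. -/
def qfRel (Q₁ Q₂ : ℤ × ℤ × ℤ) : Prop := ∃ g : Matrix.SpecialLinearGroup (Fin 2) ℤ, qfAct g Q₁ = Q₂

/-- The set of SL₂(ℤ)-classes of positive definite integral binary quadratic forms of
discriminant −n. -/
def qfClasses (n : ℤ) : Set (Quot qfRel) :=
  {q | ∃ Q : ℤ × ℤ × ℤ, Quot.mk qfRel Q = q ∧ Q.2.1 ^ 2 - 4 * Q.1 * Q.2.2 = -n ∧ 0 < Q.1}

/-- The Hurwitz class number H(n): H(0) = −1/12; for n > 0 with n ≡ 0, 3 (mod 4), H(n) is the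
number of SL₂(ℤ)-classes of positive definite integral binary quadratic forms of discriminant
−n, where the class containing a multiple of x²+y² is counted with weight 1/2 and the class
containing a multiple of x²+xy+y² with weight 1/3; H(n) = 0 otherwise. -/
noncomputable def hurwitzH (n : ℤ) : ℝ :=
  if n = 0 then -(1 / 12)
  else if 0 < n ∧ (n % 4 = 0 ∨ n % 4 = 3) then
    ((qfClasses n).ncard : ℝ)
      - 1 / 2 * (({q ∈ qfClasses n | ∃ k : ℤ, Quot.mk qfRel (k, 0, k) = q}).ncard : ℝ)
      - 2 / 3 * (({q ∈ qfClasses n | ∃ k : ℤ, Quot.mk qfRel (k, k, k) = q}).ncard : ℝ)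
  else 0

theorem qfAct_one (Q : ℤ × ℤ × ℤ) : qfAct 1 Q = Q := by
  simp [qfAct]

theorem qfAct_mul (g h : Matrix.SpecialLinearGroup (Fin 2) ℤ) (Q : ℤ × ℤ × ℤ) :
    qfAct (g * h) Q = qfAct g (qfAct h Q) := by
  simp only [qfAct, Matrix.SpecialLinearGroup.coe_mul, Matrix.mul_apply, Fin.sum_univ_two,
    Prod.mk.injEq]
  refine ⟨?_, ?_, ?_⟩ <;> ring

theorem qfRel_equivalence : Equivalence qfRel where
  refl Q := ⟨1, qfAct_one Q⟩
  symm := by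
    rintro Q _ ⟨g, rfl⟩
    exact ⟨g⁻¹, by rw [← qfAct_mul, inv_mul_cancel, qfAct_one]⟩
  trans := by
    rintro Q _ _ ⟨g, rfl⟩ ⟨h, rfl⟩
    exact ⟨h * g, qfAct_mul h g Q⟩

theorem quot_mk_qfRel_eq {Q Q' : ℤ × ℤ × ℤ} :
    Quot.mk qfRel Q = Quot.mk qfRel Q' ↔ qfRel Q Q' := by
  rw [Quot.eq, qfRel_equivalence.eqvGen_iff]

theorem qfRel_of_entries (p q r s a b c : ℤ) (h : p * s - q * r = 1) :
    qfRel (a, b, c) (a * p ^ 2 + b * p * q + c * q ^ 2,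
      2 * a * p * r + b * (p * s + q * r) + 2 * c * q * s,
      a * r ^ 2 + b * r * s + c * s ^ 2) :=
  ⟨⟨!![p, q; r, s], by rw [Matrix.det_fin_two_of, h]⟩, by simp [qfAct]⟩

theorem exists_entries_of_qfRel {a b c a' b' c' : ℤ} (h : qfRel (a, b, c) (a', b', c')) :
    ∃ p q r s : ℤ, p * s - q * r = 1 ∧ a' = a * p ^ 2 + b * p * q + c * q ^ 2 ∧
      b' = 2 * a * p * r + b * (p * s + q * r) + 2 * c * q * s ∧
      c' = a * r ^ 2 + b * r * s + c * s ^ 2 := by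
  obtain ⟨g, hg⟩ := h
  simp only [qfAct, Prod.mk.injEq] at hg
  refine ⟨g.1 0 0, g.1 0 1, g.1 1 0, g.1 1 1, ?_, hg.1.symm, hg.2.1.symm, hg.2.2.symm⟩
  rw [← Matrix.det_fin_two, g.2]

theorem discrim_eq_of_qfRel {a b c a' b' c' : ℤ} (h : qfRel (a, b, c) (a', b', c')) :
    b' ^ 2 - 4 * a' * c' = b ^ 2 - 4 * a * c := by
  obtain ⟨p, q, r, s, hdet, rfl, rfl, rfl⟩ := exists_entries_of_qfRel h
  linear_combination (b ^ 2 - 4 * a * c) * (p * s - q * r + 1) * hdet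

theorem pos_of_qfRel {a b c a' b' c' : ℤ} (h : qfRel (a, b, c) (a', b', c')) (ha : 0 < a)
    (hd : b ^ 2 - 4 * a * c < 0) : 0 < a' := by
  obtain ⟨p, q, r, s, hdet, rfl, -, -⟩ := exists_entries_of_qfRel h
  have key : 4 * a * (a * p ^ 2 + b * p * q + c * q ^ 2) =
      (2 * a * p + b * q) ^ 2 + (4 * a * c - b ^ 2) * q ^ 2 := by ring
  have hpos : 0 < (2 * a * p + b * q) ^ 2 + (4 * a * c - b ^ 2) * q ^ 2 := by
    rcases eq_or_ne q 0 with rfl | hq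
    · have hp : p ≠ 0 := by rintro rfl; simp at hdet
      have : 2 * a * p + b * 0 ≠ 0 := by simp [hp, ha.ne']
      nlinarith [sq_pos_of_ne_zero this]
    · have : 0 < 4 * a * c - b ^ 2 := by linarith
      positivity
  rw [← key] at hpos
  exact pos_of_mul_pos_right hpos (by positivity)

/-- A form `[a, b, c]` with `-a < b ≤ a < c`, or `0 ≤ b ≤ a = c`. -/
def IsReducedForm (Q : ℤ × ℤ × ℤ) : Prop :=
  0 < Q.1 ∧ ((-Q.1 < Q.2.1 ∧ Q.2.1 ≤ Q.1 ∧ Q.1 < Q.2.2) ∨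
    (0 ≤ Q.2.1 ∧ Q.2.1 ≤ Q.1 ∧ Q.1 = Q.2.2))

theorem exists_isReducedForm (a b c : ℤ) (ha : 0 < a) (hd : b ^ 2 - 4 * a * c < 0) :
    ∃ Q, IsReducedForm Q ∧ qfRel (a, b, c) Q := by
  induction hN : a.toNat using Nat.strong_induction_on generalizing a b c with
  | _ N ih =>
    obtain ⟨k, hk⟩ : ∃ k : ℤ, -a < b + 2 * a * k ∧ b + 2 * a * k ≤ a := by
      refine ⟨-((b + a - 1) / (2 * a)), ?_⟩
      have h1 := Int.emod_add_mul_ediv (b + a - 1) (2 * a)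
      have h2 := Int.emod_nonneg (b + a - 1) (by omega : 2 * a ≠ 0)
      have h3 := Int.emod_lt_of_pos (b + a - 1) (by omega : 0 < 2 * a)
      constructor <;> linarith
    have htr := qfRel_of_entries 1 0 k 1 a b c (by ring)
    have hd1 := discrim_eq_of_qfRel htr
    have e1 : a * 1 ^ 2 + b * 1 * 0 + c * 0 ^ 2 = a := by ring
    have e2 : 2 * a * 1 * k + b * (1 * 1 + 0 * k) + 2 * c * 0 * 1 = b + 2 * a * k := by ring
    rw [e1, e2] at htr hd1
    generalize b + 2 * a * k = b₁ at *
    generalize a * k ^ 2 + b * k * 1 + c * 1 ^ 2 = c₁ at *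
    have hc₁ : 0 < c₁ := by
      by_contra! h
      nlinarith [sq_nonneg b₁, mul_nonneg ha.le (neg_nonneg.2 h)]
    have hsw := qfRel_of_entries 0 1 (-1) 0 a b₁ c₁ (by ring)
    have e3 : a * 0 ^ 2 + b₁ * 0 * 1 + c₁ * 1 ^ 2 = c₁ := by ring
    have e4 : 2 * a * 0 * (-1) + b₁ * (0 * 0 + 1 * (-1)) + 2 * c₁ * 1 * 0 = -b₁ := by ring
    have e5 : a * (-1) ^ 2 + b₁ * (-1) * 0 + c₁ * 0 ^ 2 = a := by ring
    rw [e3, e4, e5] at hsw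
    have hsw' := qfRel_equivalence.trans htr hsw
    rcases lt_trichotomy a c₁ with hlt | heq | hgt
    · exact ⟨_, ⟨ha, Or.inl ⟨hk.1, hk.2, hlt⟩⟩, htr⟩
    · rcases le_or_gt 0 b₁ with hb | hb
      · exact ⟨_, ⟨ha, Or.inr ⟨hb, hk.2, heq⟩⟩, htr⟩
      · refine ⟨_, ⟨hc₁, Or.inr ⟨?_, ?_, ?_⟩⟩, hsw'⟩ <;> simp only <;> omega
    · obtain ⟨Q, hQ, hrel⟩ := ih c₁.toNat (by omega) c₁ (-b₁) a hc₁ (by linarith) rfl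
      exact ⟨Q, hQ, qfRel_equivalence.trans hsw' hrel⟩

theorem IsReducedForm.eq_of_qfRel_of_le {a b c a' b' c' : ℤ} (hQ : IsReducedForm (a, b, c))
    (hQ' : IsReducedForm (a', b', c')) (h : qfRel (a, b, c) (a', b', c')) (hle : a' ≤ a) :
    (a, b, c) = (a', b', c') := by
  have hdisc := discrim_eq_of_qfRel h
  obtain ⟨p, q, r, s, hdet, ha', hb', hc'⟩ := exists_entries_of_qfRel h
  simp only [IsReducedForm] at hQ hQ'
  obtain ⟨ha, hQ⟩ := hQ
  obtain ⟨hapos', hQ'⟩ := hQ'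
  have hac : a ≤ c := by omega
  have hac' : a' ≤ c' := by omega
  have hb : -a < b ∧ b ≤ a := by omega
  have hb₂ : -a' < b' ∧ b' ≤ a' := by omega
  have hba : b ^ 2 ≤ a ^ 2 := by nlinarith
  have hq : q ^ 2 ≤ 1 := by
    have key : 4 * a * a' = (2 * a * p + b * q) ^ 2 + (4 * a * c - b ^ 2) * q ^ 2 := by
      rw [ha']; ring
    by_contra! hq
    nlinarith [sq_nonneg (2 * a * p + b * q), mul_le_mul_of_nonneg_left hac ha.le,
      mul_le_mul_of_nonneg_left hle ha.le, mul_pos ha ha]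
  have hfin : a' = a → b' = b → (a, b, c) = (a', b', c') := by
    intro h1 h2
    rw [h1, h2] at hdisc ⊢
    have : a * c = a * c' := by linarith
    rw [mul_left_cancel₀ ha.ne' this]
  have hq' : q = -1 ∨ q = 0 ∨ q = 1 := by
    have : |q| ≤ 1 := abs_le_one_iff_mul_self_le_one.2 (by rwa [← sq])
    rw [abs_le] at this
    omega
  by_cases hq0 : q = 0
  · subst hq0
    have hps : p * s = 1 := by linarith
    have hpp : p ^ 2 = 1 := by
      rcases Int.eq_one_or_neg_one_of_mul_eq_one hps with rfl | rfl <;> rfl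
    have haa : a' = a := by rw [ha', hpp]; ring
    have hbb : b' = 2 * a * (p * r) + b := by rw [hb']; linear_combination b * hps
    refine hfin haa ?_
    have h1 : p * r < 1 := by
      by_contra! h1
      nlinarith [mul_le_mul_of_nonneg_left h1 ha.le]
    have h2 : -1 < p * r := by
      by_contra! h2
      nlinarith [mul_le_mul_of_nonneg_left h2 ha.le]
    rw [hbb, show p * r = 0 by omega]
    ring
  · have hqq : q ^ 2 = 1 := by rcases hq' with h | h | h <;> simp [h] at hq0 ⊢
    have hp2 : p ^ 2 ≤ 1 := by
      have key : 4 * a * a' = (2 * a * p + b * q) ^ 2 + (4 * a * c - b ^ 2) := by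
        rw [ha']; linear_combination (4 * a * c - b ^ 2) * hqq
      have h4 : (2 * a * p + b * q) ^ 2 ≤ a ^ 2 := by nlinarith
      have h5 : (2 * a * p) ^ 2 ≤ (2 * a) ^ 2 := by
        have h6 := abs_le_of_sq_le_sq h4 ha.le
        have h7 : |b * q| ≤ a := abs_le_of_sq_le_sq (by rw [mul_pow, hqq, mul_one]; exact hba) ha.le
        rw [abs_le] at h6 h7
        nlinarith
      nlinarith [mul_pos ha ha]
    have hp' : p = -1 ∨ p = 0 ∨ p = 1 := by
      have : |p| ≤ 1 := abs_le_one_iff_mul_self_le_one.2 (by rwa [← sq])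
      rw [abs_le] at this
      omega
    by_cases hp0 : p = 0
    · subst hp0
      have hca : a' = c := by rw [ha', hqq]; ring
      have hbb : b' = -b + 2 * c * (q * s) := by rw [hb']; linear_combination -b * hdet
      have hcc : c = a := by omega
      have h1 : q * s < 2 := by
        by_contra! h1
        nlinarith [mul_le_mul_of_nonneg_left h1 ha.le]
      have h2 : -1 < q * s := by
        by_contra! h2
        nlinarith [mul_le_mul_of_nonneg_left h2 ha.le]
      subst hcc
      obtain h3 | h3 : q * s = 0 ∨ q * s = 1 := by omega
      · rw [h3] at hbb
        have hc1 : c = c' := by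
          rw [hca, hbb] at hdisc
          exact mul_left_cancel₀ ha.ne' (by linarith)
        exact hfin hca (by omega)
      · rw [h3] at hbb
        exact hfin hca (by omega)
    · have hpp : p ^ 2 = 1 := by rcases hp' with h | h | h <;> simp [h] at hp0 ⊢
      have haa : a' = a + b * (p * q) + c := by rw [ha', hpp, hqq]; ring
      have hpq : p * q = 1 ∨ p * q = -1 := by
        rw [← mul_self_eq_one_iff]
        linear_combination hqq * p ^ 2 + hpp
      rcases hpq with hpq | hpq
      · rw [hpq] at haa
        omega
      · rw [hpq] at haa
        have hca : c = a := by omega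
        have hba : b = a := by omega
        have haa' : a' = a := by omega
        rw [haa', hca, hba] at hdisc
        rw [haa'] at hac'
        refine hfin haa' ?_
        have : a ^ 2 ≤ b' ^ 2 := by nlinarith
        rw [sq_le_sq, abs_of_pos ha, le_abs] at this
        omega

theorem IsReducedForm.eq_of_qfRel {Q Q' : ℤ × ℤ × ℤ} (hQ : IsReducedForm Q)
    (hQ' : IsReducedForm Q') (h : qfRel Q Q') : Q = Q' := by
  obtain ⟨a, b, c⟩ := Q
  obtain ⟨a', b', c'⟩ := Q'
  rcases le_total a' a with hle | hle
  · exact hQ.eq_of_qfRel_of_le hQ' h hle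
  · exact (hQ'.eq_of_qfRel_of_le hQ (qfRel_equivalence.symm h) hle).symm

/-- The reduced forms of discriminant `-n`. -/
def reducedForms (n : ℤ) : Set (ℤ × ℤ × ℤ) :=
  {Q | IsReducedForm Q ∧ Q.2.1 ^ 2 - 4 * Q.1 * Q.2.2 = -n}

theorem IsReducedForm.discrim_neg {a b c : ℤ} (h : IsReducedForm (a, b, c)) :
    b ^ 2 - 4 * a * c < 0 := by
  simp only [IsReducedForm] at h
  obtain ⟨ha, h⟩ := h
  have hac : a ≤ c := by omega
  have hb : -a ≤ b ∧ b ≤ a := by omega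
  nlinarith

theorem reducedForms_eq_empty {n : ℤ} (hn : n ≤ 0) : reducedForms n = ∅ := by
  refine Set.eq_empty_of_forall_notMem ?_
  rintro ⟨a, b, c⟩ ⟨h, hd⟩
  have := h.discrim_neg
  simp only at hd
  omega

theorem injOn_quot_mk_reducedForms (n : ℤ) : (reducedForms n).InjOn (Quot.mk qfRel) :=
  fun _ hQ _ hQ' h => hQ.1.eq_of_qfRel hQ'.1 (quot_mk_qfRel_eq.1 h)

theorem exists_reducedForms_of_mem_qfClasses {n : ℤ} (hn : 0 < n) {q : Quot qfRel}
    (hq : q ∈ qfClasses n) : ∃ Q ∈ reducedForms n, Quot.mk qfRel Q = q := by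
  obtain ⟨⟨a, b, c⟩, rfl, hd, ha⟩ := hq
  simp only at hd ha
  obtain ⟨⟨a', b', c'⟩, hQ, hrel⟩ := exists_isReducedForm a b c ha (by omega)
  exact ⟨_, ⟨hQ, (discrim_eq_of_qfRel hrel).trans hd⟩, quot_mk_qfRel_eq.2
    (qfRel_equivalence.symm hrel)⟩

theorem image_reducedForms {n : ℤ} (hn : 0 < n) :
    Quot.mk qfRel '' reducedForms n = qfClasses n := by
  ext q
  constructor
  · rintro ⟨Q, hQ, rfl⟩
    exact ⟨Q, rfl, hQ.2, hQ.1.1⟩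
  · exact exists_reducedForms_of_mem_qfClasses hn

theorem image_reducedForms_of_family {n : ℤ} (hn : 0 < n) (t : ℤ → ℤ × ℤ × ℤ)
    (ht : ∀ k, 0 < (t k).1 → IsReducedForm (t k)) :
    Quot.mk qfRel '' {Q ∈ reducedForms n | ∃ k, t k = Q} =
      {q ∈ qfClasses n | ∃ k, Quot.mk qfRel (t k) = q} := by
  ext q
  constructor
  · rintro ⟨_, ⟨hQ, k, rfl⟩, rfl⟩
    exact ⟨⟨_, rfl, hQ.2, hQ.1.1⟩, k, rfl⟩
  · rintro ⟨hq, k, hk⟩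
    obtain ⟨⟨a, b, c⟩, hQ, rfl⟩ := exists_reducedForms_of_mem_qfClasses hn hq
    have hrel := quot_mk_qfRel_eq.1 hk
    exact ⟨_, ⟨hQ, k, (ht k (pos_of_qfRel (qfRel_equivalence.symm hrel) hQ.1.1
      hQ.1.discrim_neg)).eq_of_qfRel hQ.1 hrel⟩, rfl⟩

theorem hurwitzH_of_pos {n : ℤ} (hn : 0 < n) (h4 : n % 4 = 0 ∨ n % 4 = 3) :
    hurwitzH n = (reducedForms n).ncard
      - 1 / 2 * ({Q ∈ reducedForms n | ∃ k : ℤ, (k, 0, k) = Q}.ncard : ℝ)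
      - 2 / 3 * ({Q ∈ reducedForms n | ∃ k : ℤ, (k, k, k) = Q}.ncard : ℝ) := by
  have hinj := injOn_quot_mk_reducedForms n
  rw [hurwitzH, if_neg hn.ne', if_pos ⟨hn, h4⟩, ← image_reducedForms hn,
    hinj.ncard_image, image_reducedForms hn,
    ← image_reducedForms_of_family hn (fun k => (k, 0, k))
      fun k hk => ⟨hk, Or.inr ⟨le_rfl, hk.le, rfl⟩⟩,
    ← image_reducedForms_of_family hn (fun k => (k, k, k))
      fun k hk => ⟨hk, Or.inr ⟨hk.le, le_rfl, rfl⟩⟩,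
    (hinj.mono fun _ h => h.1).ncard_image,
    (hinj.mono fun _ h => h.1).ncard_image]

/-- The quadruples `(a, c, x, y)` with `ac + xy = m` for which the form `[a, x - y, c]`, of
discriminant `(x + y)² - 4m`, is reduced. -/
noncomputable def reducedQuadruples (m : ℕ) : Finset (ℤ × ℤ × ℤ × ℤ) :=
  {q ∈ Finset.Icc (-2 * (m : ℤ)) (2 * m) ×ˢ Finset.Icc (-2 * (m : ℤ)) (2 * m) ×ˢ
      Finset.Icc (-2 * (m : ℤ)) (2 * m) ×ˢ Finset.Icc (-2 * (m : ℤ)) (2 * m) |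
    q.1 * q.2.1 + q.2.2.1 * q.2.2.2 = m ∧ 0 < q.1 ∧
      ((-q.1 < q.2.2.1 - q.2.2.2 ∧ q.2.2.1 - q.2.2.2 ≤ q.1 ∧ q.1 < q.2.1) ∨
        (0 ≤ q.2.2.1 - q.2.2.2 ∧ q.2.2.1 - q.2.2.2 ≤ q.1 ∧ q.1 = q.2.1))}

theorem mem_reducedQuadruples {m : ℕ} {a c x y : ℤ} :
    (a, c, x, y) ∈ reducedQuadruples m ↔
      a * c + x * y = m ∧ IsReducedForm (a, x - y, c) := by
  simp only [reducedQuadruples, IsReducedForm, Finset.mem_filter, Finset.mem_product,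
    Finset.mem_Icc, and_iff_right_iff_imp]
  rintro ⟨h, ha, hr⟩
  have hac : a ≤ c := by omega
  have hb : -a ≤ x - y ∧ x - y ≤ a := by omega
  have h1 : (x - y) ^ 2 ≤ a * c := by nlinarith
  have h2 : (x + y) ^ 2 + 3 * (a * c) ≤ 4 * m := by linarith
  have h3 : c ≤ a * c := by nlinarith
  have hm : 1 ≤ (m : ℤ) := by nlinarith [sq_nonneg (x + y)]
  have h4 : |x + y| ≤ 2 * m := abs_le_of_sq_le_sq (by nlinarith) (by positivity)
  have h5 : 3 * c ≤ 4 * m := by nlinarith [sq_nonneg (x + y)]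
  rw [abs_le] at h4
  omega

theorem ncard_reducedForms_sep (m : ℕ) (r : ℤ) (p : ℤ × ℤ × ℤ → Prop) [DecidablePred p] :
    {Q ∈ reducedForms (4 * m - r ^ 2) | p Q}.ncard =
      Finset.card {q ∈ {q ∈ reducedQuadruples m | p (q.1, q.2.2.1 - q.2.2.2, q.2.1)} |
        q.2.2.1 + q.2.2.2 = r} := by
  rw [← Set.ncard_coe_finset]
  symm
  refine Set.ncard_congr (fun q _ => (q.1, q.2.2.1 - q.2.2.2, q.2.1)) ?_ ?_ ?_
  · rintro ⟨a, c, x, y⟩ hq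
    simp only [Finset.coe_filter, Finset.mem_filter, mem_reducedQuadruples,
      Set.mem_ofPred_eq] at hq
    obtain ⟨⟨⟨h, hr⟩, hp⟩, rfl⟩ := hq
    refine ⟨⟨hr, ?_⟩, hp⟩
    simp only
    linear_combination -4 * h
  · rintro ⟨a, c, x, y⟩ ⟨a', c', x', y'⟩ h h' heq
    simp only [Finset.coe_filter, Set.mem_ofPred_eq, Prod.mk.injEq] at h h' heq ⊢
    omega
  · rintro ⟨a, b, c⟩ ⟨⟨hr, hd⟩, hp⟩
    simp only at hd
    have hpar : (r + b) % 2 = 0 := by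
      have h1 : (b ^ 2 - r ^ 2) % 2 = 0 := by
        have : b ^ 2 - r ^ 2 = 2 * (2 * (a * c) - 2 * m) := by linear_combination hd
        omega
      rcases Int.emod_two_eq_zero_or_one r with h | h <;>
        rcases Int.emod_two_eq_zero_or_one b with h' | h' <;>
        simp [Int.sub_emod, Int.add_emod, pow_two, Int.mul_emod, h, h'] at h1 ⊢
    obtain ⟨x, hx⟩ : ∃ x, r + b = 2 * x := ⟨(r + b) / 2, by omega⟩
    obtain ⟨rfl, hb⟩ : r = x + (x - b) ∧ True := ⟨by omega, trivial⟩
    have hxy : x - (x - b) = b := by ring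
    refine ⟨(a, c, x, x - b), ?_, ?_⟩
    · simp only [Finset.coe_filter, Finset.mem_filter, mem_reducedQuadruples,
        Set.mem_ofPred_eq, hxy]
      exact ⟨⟨⟨by linarith, hr⟩, hp⟩, trivial⟩
    · simp only [hxy]

theorem hurwitzH_four_mul_sub_sq (m : ℕ) (r : ℤ) :
    hurwitzH (4 * m - r ^ 2) =
      (Finset.card {q ∈ reducedQuadruples m | q.2.2.1 + q.2.2.2 = r} : ℝ)
      - 1 / 2 * (Finset.card {q ∈ {q ∈ reducedQuadruples m | q.1 = q.2.1 ∧ q.2.2.1 = q.2.2.2} |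
        q.2.2.1 + q.2.2.2 = r} : ℝ)
      - 2 / 3 * (Finset.card {q ∈ {q ∈ reducedQuadruples m |
        q.1 = q.2.1 ∧ q.2.2.1 = q.2.2.2 + q.1} | q.2.2.1 + q.2.2.2 = r} : ℝ)
      - if r ^ 2 = 4 * m then 1 / 12 else 0 := by
  have h1 := ncard_reducedForms_sep m r fun _ => True
  have h2 := ncard_reducedForms_sep m r fun Q => Q.1 = Q.2.2 ∧ Q.2.1 = 0
  have h3 := ncard_reducedForms_sep m r fun Q => Q.1 = Q.2.2 ∧ Q.2.1 = Q.1
  simp only [and_true, Set.ofPred_mem_eq, Finset.filter_true, sub_eq_iff_eq_add', add_zero]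
    at h1 h2 h3
  rw [← h1, ← h2, ← h3]
  rcases le_or_gt (4 * m - r ^ 2) 0 with hn | hn
  · simp only [reducedForms_eq_empty hn, Set.mem_empty_iff_false, false_and, Set.ofPred_false,
      Set.ncard_empty, hurwitzH, hn.not_gt, if_false]
    split_ifs <;> first | omega | norm_num
  · rw [if_neg (by omega), hurwitzH_of_pos hn, sub_zero]
    · have e1 (Q : ℤ × ℤ × ℤ) : (∃ k, (k, 0, k) = Q) ↔ Q.1 = Q.2.2 ∧ Q.2.1 = 0 :=
        ⟨by rintro ⟨k, rfl⟩; simp, fun ⟨h, h'⟩ => ⟨Q.1, Prod.ext rfl (Prod.ext h'.symm h)⟩⟩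
      have e2 (Q : ℤ × ℤ × ℤ) : (∃ k, (k, k, k) = Q) ↔ Q.1 = Q.2.2 ∧ Q.2.1 = Q.1 :=
        ⟨by rintro ⟨k, rfl⟩; simp, fun ⟨h, h'⟩ => ⟨Q.1, Prod.ext rfl (Prod.ext h'.symm h)⟩⟩
      simp only [e1, e2]
    · have : r ^ 2 % 4 = 0 ∨ r ^ 2 % 4 = 1 := by
        rcases Int.even_or_odd' r with ⟨k, rfl | rfl⟩
        · left; ring_nf; omega
        · right; ring_nf; omega
      omega

theorem card_filter_sq_eq_four_mul (m : ℕ) (hm : 0 < m) :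
    Finset.card {r ∈ Finset.Icc (-2 * (m : ℤ)) (2 * m) | r ^ 2 = 4 * (m : ℤ)} =
      2 * Finset.card {p ∈ m.divisorsAntidiagonal | p.1 = p.2} := by
  by_cases h : ∃ k, m = k * k
  · obtain ⟨k, rfl⟩ := h
    have hk : 0 < k := Nat.pos_of_mul_pos_right hm
    have h1 : {r ∈ Finset.Icc (-2 * ((k * k : ℕ) : ℤ)) (2 * (k * k : ℕ)) |
        r ^ 2 = 4 * ((k * k : ℕ) : ℤ)} = {2 * (k : ℤ), -(2 * (k : ℤ))} := by
      ext r
      simp only [Finset.mem_filter, Finset.mem_Icc, Finset.mem_insert, Finset.mem_singleton]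
      rw [← sq_eq_sq_iff_eq_or_eq_neg]
      push_cast
      constructor
      · rintro ⟨-, h⟩
        rw [h]; ring
      · intro h
        have : |r| ≤ 2 * (k * k) := abs_le_of_sq_le_sq (by nlinarith) (by positivity)
        rw [abs_le] at this
        exact ⟨by constructor <;> linarith, by rw [h]; ring⟩
    have h2 : {p ∈ (k * k).divisorsAntidiagonal | p.1 = p.2} = {(k, k)} := by
      ext ⟨i, j⟩
      simp only [Finset.mem_filter, Nat.mem_divisorsAntidiagonal, Finset.mem_singleton,
        Prod.mk.injEq]
      constructor
      · rintro ⟨⟨h, -⟩, rfl⟩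
        simpa using Nat.mul_self_inj.1 h
      · rintro ⟨rfl, rfl⟩
        exact ⟨⟨rfl, hm.ne'⟩, rfl⟩
    rw [h1, h2, Finset.card_pair (by omega), Finset.card_singleton]
  · rw [Finset.filter_false_of_mem, Finset.filter_false_of_mem]
    · rfl
    · rintro ⟨i, j⟩ hp (rfl : i = j)
      exact h ⟨i, (Nat.mem_divisorsAntidiagonal.1 hp).1.symm⟩
    · intro r _ hr
      obtain ⟨k, rfl⟩ : Even r := by
        have : Even (r ^ 2) := ⟨2 * m, by omega⟩
        exact (Int.even_pow.1 this).1
      refine h ⟨k.natAbs, ?_⟩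
      zify
      rw [abs_mul_abs_self]
      linarith

theorem finsum_hurwitzH (m : ℕ) (hm : 0 < m) :
    {r : ℤ | hurwitzH (4 * (m : ℤ) - r ^ 2) ≠ 0}.Finite ∧
    ∑ᶠ r : ℤ, hurwitzH (4 * (m : ℤ) - r ^ 2) =
      ((reducedQuadruples m).card : ℝ)
      - 1 / 2 * (Finset.card {q ∈ reducedQuadruples m | q.1 = q.2.1 ∧ q.2.2.1 = q.2.2.2} : ℝ)
      - 2 / 3 * (Finset.card {q ∈ reducedQuadruples m |
        q.1 = q.2.1 ∧ q.2.2.1 = q.2.2.2 + q.1} : ℝ)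
      - 1 / 6 * (Finset.card {p ∈ m.divisorsAntidiagonal | p.1 = p.2} : ℝ) := by
  have hsupp : Function.support (fun r : ℤ => hurwitzH (4 * (m : ℤ) - r ^ 2)) ⊆
      Finset.Icc (-2 * (m : ℤ)) (2 * m) := by
    intro r hr
    have hr' : 0 ≤ 4 * (m : ℤ) - r ^ 2 := by
      by_contra! h
      exact hr (by simp only [hurwitzH, h.ne, h.not_gt, if_false, false_and])
    have : |r| ≤ 2 * m := abs_le_of_sq_le_sq (by nlinarith) (by positivity)
    rw [abs_le] at this
    simpa using this
  refine ⟨(Finset.finite_toSet _).subset hsupp, ?_⟩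
  have hfib (s : Finset (ℤ × ℤ × ℤ × ℤ)) (hs : s ⊆ reducedQuadruples m) :
      (s.card : ℝ) = ∑ r ∈ Finset.Icc (-2 * (m : ℤ)) (2 * m),
        (Finset.card {q ∈ s | q.2.2.1 + q.2.2.2 = r} : ℝ) := by
    rw [Finset.card_eq_sum_card_fiberwise (f := fun q => q.2.2.1 + q.2.2.2)
      (t := Finset.Icc (-2 * (m : ℤ)) (2 * m)), Nat.cast_sum]
    rintro ⟨a, c, x, y⟩ hq
    obtain ⟨h, hr⟩ := mem_reducedQuadruples.1 (hs hq)
    have hd := hr.discrim_neg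
    have : |x + y| ≤ 2 * m := abs_le_of_sq_le_sq (by nlinarith) (by positivity)
    rw [abs_le] at this
    simpa using this
  rw [finsum_eq_sum_of_support_subset _ hsupp, hfib _ subset_rfl,
    hfib _ (Finset.filter_subset _ _), hfib _ (Finset.filter_subset _ _)]
  simp only [hurwitzH_four_mul_sub_sq, Finset.sum_sub_distrib, ← Finset.mul_sum]
  rw [← Finset.sum_filter, Finset.sum_const, card_filter_sq_eq_four_mul m hm]
  simp only [nsmul_eq_mul]
  push_cast
  ring

/-- The quadruples `(a, c, x, y)` of positive integers with `ac + xy = m`. -/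
noncomputable def positiveQuadruples (m : ℕ) : Finset (ℤ × ℤ × ℤ × ℤ) :=
  {q ∈ Finset.Icc 1 (m : ℤ) ×ˢ Finset.Icc 1 (m : ℤ) ×ˢ Finset.Icc 1 (m : ℤ) ×ˢ
    Finset.Icc 1 (m : ℤ) | q.1 * q.2.1 + q.2.2.1 * q.2.2.2 = m}

theorem mem_positiveQuadruples {m : ℕ} {a c x y : ℤ} :
    (a, c, x, y) ∈ positiveQuadruples m ↔
      a * c + x * y = m ∧ 0 < a ∧ 0 < c ∧ 0 < x ∧ 0 < y := by
  simp only [positiveQuadruples, Finset.mem_filter, Finset.mem_product, Finset.mem_Icc]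
  constructor
  · rintro ⟨h, h'⟩
    exact ⟨h', by omega⟩
  · rintro ⟨h, ha, hc, hx, hy⟩
    refine ⟨⟨⟨ha, ?_⟩, ⟨hc, ?_⟩, ⟨hx, ?_⟩, hy, ?_⟩, h⟩ <;> nlinarith [mul_pos ha hc, mul_pos hx hy]

/-- One step of the Euclidean algorithm on the lattice basis `(x, -c), (a, y)`: the basis vector
lying in the same quadrant as the sum of the two is replaced by that sum. -/
def euclidStep (q : ℤ × ℤ × ℤ × ℤ) : ℤ × ℤ × ℤ × ℤ :=
  if q.2.1 < q.2.2.2 then (q.1 + q.2.2.1, q.2.1, q.2.2.1, q.2.2.2 - q.2.1)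
  else (q.1, q.2.1 - q.2.2.2, q.2.2.1 + q.1, q.2.2.2)

theorem sum_euclidStep (m : ℕ) (h : ℤ × ℤ × ℤ × ℤ → ℤ) :
    ∑ q ∈ positiveQuadruples m with q.2.2.2 ≠ q.2.1, h (euclidStep q) =
      ∑ q ∈ positiveQuadruples m with q.1 ≠ q.2.2.1, h q := by
  refine Finset.sum_nbij' euclidStep
    (fun q => if q.2.2.1 < q.1 then (q.1 - q.2.2.1, q.2.1, q.2.2.1, q.2.2.2 + q.2.1)
      else (q.1, q.2.1 + q.2.2.2, q.2.2.1 - q.1, q.2.2.2)) ?_ ?_ ?_ ?_ fun _ _ => rfl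
  all_goals
    rintro ⟨a, c, x, y⟩ hq
    simp only [Finset.mem_filter, mem_positiveQuadruples] at hq
    obtain ⟨⟨h, ha, hc, hx, hy⟩, hne⟩ := hq
  · dsimp only [euclidStep]
    split_ifs <;> simp only [Finset.mem_filter, mem_positiveQuadruples] <;>
      exact ⟨⟨by linarith, by omega⟩, by omega⟩
  · dsimp only
    split_ifs <;> simp only [Finset.mem_filter, mem_positiveQuadruples] <;>
      exact ⟨⟨by linarith, by omega⟩, by omega⟩
  · rcases lt_or_gt_of_ne hne with hlt | hlt
    · simp [euclidStep, hlt.not_gt, hx.not_gt]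
    · simp [euclidStep, hlt, ha.not_ge]
  · rcases lt_or_gt_of_ne hne with hlt | hlt
    · simp [euclidStep, hlt.not_gt, hc.le]
    · simp [euclidStep, hlt, hy]

/-- The left-hand side telescopes along the orbits of `euclidStep`. -/
theorem card_add_card_add_card_positiveQuadruples (m : ℕ) (δ : ℤ) (h0 : 0 ≤ δ) (h1 : δ ≤ 1) :
    (Finset.card {q ∈ positiveQuadruples m |
        q.2.2.2 + δ ≤ q.2.2.1 ∧ q.2.2.1 < q.2.2.2 + q.1 + δ ∧ q.1 < q.2.1 + δ} : ℤ)
      + Finset.card {q ∈ positiveQuadruples m |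
        q.2.2.2 < q.2.1 ∧ q.1 + q.2.2.1 < q.2.1 + δ ∧ q.2.1 + δ ≤ q.1 + q.2.2.2}
      + Finset.card {q ∈ positiveQuadruples m |
        q.1 < q.2.1 + δ ∧ q.2.1 + δ ≤ q.1 + q.2.2.1 ∧ q.2.2.1 < q.2.2.2 + δ} =
    Finset.card {q ∈ positiveQuadruples m | q.2.2.2 = q.2.1 ∧ q.2.1 + δ ≤ q.1 + q.2.2.1}
      - Finset.card {q ∈ positiveQuadruples m | q.1 = q.2.2.1 ∧ q.2.1 + δ ≤ q.1} := by
  set h : ℤ × ℤ × ℤ × ℤ → ℤ := fun q =>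
    if q.2.1 + δ ≤ q.1 ∨ q.2.2.2 + q.1 + δ ≤ q.2.2.1 then 1 else 0 with hh
  have hstep := sum_euclidStep m h
  rw [Finset.sum_filter, Finset.sum_filter] at hstep
  rw [← sub_eq_zero] at hstep ⊢
  simp only [Finset.natCast_card_filter]
  rw [← Finset.sum_sub_distrib] at hstep
  rw [← Finset.sum_add_distrib, ← Finset.sum_add_distrib, ← Finset.sum_sub_distrib,
    ← Finset.sum_sub_distrib]
  refine Eq.trans (Finset.sum_congr rfl ?_) hstep
  rintro ⟨a, c, x, y⟩ hq
  obtain ⟨-, ha, hc, hx, hy⟩ := mem_positiveQuadruples.1 hq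
  rcases lt_trichotomy y c with hyc | rfl | hyc
  · simp only [hh, euclidStep, hyc, hyc.ne, hyc.not_gt, ne_eq, not_false_eq_true, if_true, if_false,
      true_and, false_and]
    split_ifs <;> omega
  · simp only [hh, lt_irrefl, ne_eq, not_true_eq_false, if_false, true_and, false_and]
    split_ifs <;> omega
  · simp only [hh, euclidStep, hyc, hyc.ne', hyc.not_gt, ne_eq, not_false_eq_true, if_true, if_false,
      false_and]
    split_ifs <;> omega

theorem card_eq_sum_divisorsAntidiagonal {α : Type*} (m : ℕ) (s : Finset α)
    (e : ℤ → ℤ → ℤ → α) (l u : ℤ → ℤ → ℤ)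
    (hmem : ∀ d d' t : ℤ, d * d' = m → 0 < d → 0 < d' → l d d' ≤ t → t ≤ u d d' → e d d' t ∈ s)
    (hinj : ∀ d d' t k k' j : ℤ, 0 < d → 0 < d' → l d d' ≤ t → t ≤ u d d' → 0 < k → 0 < k' →
      l k k' ≤ j → j ≤ u k k' → e d d' t = e k k' j → d = k ∧ d' = k' ∧ t = j)
    (hsurj : ∀ q ∈ s, ∃ d d' t : ℤ, d * d' = m ∧ 0 < d ∧ 0 < d' ∧ l d d' ≤ t ∧ t ≤ u d d' ∧
      e d d' t = q) :
    (s.card : ℤ) = ∑ p ∈ m.divisorsAntidiagonal, max 0 (u p.1 p.2 + 1 - l p.1 p.2) := by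
  have hpos {p : ℕ × ℕ} (hp : p ∈ m.divisorsAntidiagonal) :
      (p.1 : ℤ) * p.2 = m ∧ 0 < (p.1 : ℤ) ∧ 0 < (p.2 : ℤ) := by
    obtain ⟨h, h'⟩ := Nat.mem_divisorsAntidiagonal.1 hp
    rw [← h] at h' ⊢
    obtain ⟨h1, h2⟩ := mul_ne_zero_iff.1 h'
    push_cast
    exact ⟨rfl, by omega, by omega⟩
  have hcard : (m.divisorsAntidiagonal.sigma fun p : ℕ × ℕ =>
      Finset.Icc (l p.1 p.2) (u p.1 p.2)).card = s.card := by
    refine Finset.card_bij (fun z _ => e z.1.1 z.1.2 z.2) ?_ ?_ ?_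
    · rintro ⟨p, t⟩ hz
      simp only [Finset.mem_sigma, Finset.mem_Icc] at hz
      obtain ⟨h, h1, h2⟩ := hpos hz.1
      exact hmem _ _ _ h h1 h2 hz.2.1 hz.2.2
    · rintro ⟨⟨d, d'⟩, t⟩ hz ⟨⟨k, k'⟩, j⟩ hz' he
      simp only [Finset.mem_sigma, Finset.mem_Icc] at hz hz'
      obtain ⟨-, h1, h2⟩ := hpos hz.1
      obtain ⟨-, h1', h2'⟩ := hpos hz'.1
      obtain ⟨hd, hd', rfl⟩ :=
        hinj _ _ _ _ _ _ h1 h2 hz.2.1 hz.2.2 h1' h2' hz'.2.1 hz'.2.2 he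
      obtain rfl := Nat.cast_injective hd
      obtain rfl := Nat.cast_injective hd'
      rfl
    · intro q hq
      obtain ⟨d, d', t, h, h1, h2, hl, hu, rfl⟩ := hsurj q hq
      lift d to ℕ using h1.le
      lift d' to ℕ using h2.le
      refine ⟨⟨(d, d'), t⟩, ?_, rfl⟩
      simp only [Finset.mem_sigma, Finset.mem_Icc, Nat.mem_divisorsAntidiagonal]
      have h' : d * d' = m := by exact_mod_cast h
      exact ⟨⟨h', h' ▸ mul_ne_zero (by omega) (by omega)⟩, hl, hu⟩
  rw [← hcard, Finset.card_sigma, Nat.cast_sum]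
  simp only [Int.card_Icc, Int.ofNat_toNat, max_comm]

theorem card_filter_positiveQuadruples_snd_eq (m : ℕ) (δ : ℤ) (h0 : 0 ≤ δ) :
    (Finset.card {q ∈ positiveQuadruples m | q.2.2.2 = q.2.1 ∧ q.2.1 + δ ≤ q.1 + q.2.2.1} : ℤ) =
      ∑ p ∈ m.divisorsAntidiagonal, if (p.1 : ℤ) + δ ≤ p.2 then (p.2 : ℤ) - 1 else 0 := by
  rw [card_eq_sum_divisorsAntidiagonal m _ (fun d d' t => (t, d, d' - t, d)) (fun _ _ => 1)
    (fun d d' => if d + δ ≤ d' then d' - 1 else 0)]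
  · refine Finset.sum_congr rfl fun p hp => ?_
    have := Nat.pos_of_mem_divisors (Nat.fst_mem_divisors_of_mem_antidiagonal hp)
    split_ifs <;> omega
  · intro d d' t h hd hd' h1 h2
    simp only [Finset.mem_filter, mem_positiveQuadruples, true_and]
    split_ifs at h2
    · exact ⟨⟨by linarith, by omega⟩, by omega⟩
    · omega
  · intro d d' t k k' j _ _ _ _ _ _ _ _ h
    simp only [Prod.mk.injEq] at h
    omega
  · rintro ⟨a, c, x, y⟩ hq
    simp only [Finset.mem_filter, mem_positiveQuadruples] at hq
    obtain ⟨⟨h, ha, hc, hx, hy⟩, rfl, hle⟩ := hq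
    exact ⟨y, a + x, a, by linarith, hy, by omega, ha, by rw [if_pos hle]; omega, by simp⟩

theorem card_filter_positiveQuadruples_fst_eq (m : ℕ) (δ : ℤ) (h0 : 0 ≤ δ) (h1 : δ ≤ 1) :
    (Finset.card {q ∈ positiveQuadruples m | q.1 = q.2.2.1 ∧ q.2.1 + δ ≤ q.1} : ℤ) =
      ∑ p ∈ m.divisorsAntidiagonal, min ((p.1 : ℤ) - δ) (p.2 - 1) := by
  rw [card_eq_sum_divisorsAntidiagonal m _ (fun d d' t => (d, t, d, d' - t)) (fun _ _ => 1)
    (fun d d' => min (d - δ) (d' - 1))]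
  · refine Finset.sum_congr rfl fun p hp => ?_
    have := Nat.pos_of_mem_divisors (Nat.fst_mem_divisors_of_mem_antidiagonal hp)
    have := Nat.pos_of_mem_divisors (Nat.snd_mem_divisors_of_mem_antidiagonal hp)
    omega
  · intro d d' t h hd hd' h1 h2
    simp only [Finset.mem_filter, mem_positiveQuadruples, true_and]
    exact ⟨⟨by linarith, by omega⟩, by omega⟩
  · intro d d' t k k' j _ _ _ _ _ _ _ _ h
    simp only [Prod.mk.injEq] at h
    omega
  · rintro ⟨a, c, x, y⟩ hq
    simp only [Finset.mem_filter, mem_positiveQuadruples] at hq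
    obtain ⟨⟨h, ha, hc, hx, hy⟩, rfl, hle⟩ := hq
    exact ⟨a, c + y, c, by linarith, hx, by omega, hc, by omega, by simp⟩

theorem card_filter_reducedQuadruples_snd_eq_zero (m : ℕ) :
    (Finset.card {q ∈ reducedQuadruples m | q.2.2.2 = 0} : ℤ) =
      ∑ p ∈ m.divisorsAntidiagonal,
        if p.1 < p.2 then 2 * (p.1 : ℤ) else if p.1 = p.2 then (p.1 : ℤ) + 1 else 0 := by
  rw [card_eq_sum_divisorsAntidiagonal m _ (fun d d' t => (d, d', t, 0))
    (fun d d' => if d < d' then -d + 1 else if d = d' then 0 else d + 1) (fun d _ => d)]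
  · refine Finset.sum_congr rfl fun p _ => ?_
    split_ifs <;> omega
  · intro d d' t h hd hd' h1 h2
    simp only [Finset.mem_filter, mem_reducedQuadruples, IsReducedForm, and_true]
    split_ifs at h1 <;> exact ⟨by linarith, by omega⟩
  · intro d d' t k k' j _ _ _ _ _ _ _ _ h
    simp only [Prod.mk.injEq] at h
    omega
  · rintro ⟨a, c, x, y⟩ hq
    simp only [Finset.mem_filter, mem_reducedQuadruples, IsReducedForm] at hq
    obtain ⟨⟨h, ha, hr⟩, rfl⟩ := hq
    exact ⟨a, c, x, by linarith, ha, by omega, by split_ifs <;> omega, by omega, rfl⟩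

theorem card_filter_reducedQuadruples_fst_eq_zero (m : ℕ) :
    (Finset.card {q ∈ reducedQuadruples m | q.2.2.1 = 0} : ℤ) =
      ∑ p ∈ m.divisorsAntidiagonal,
        if p.1 < p.2 then 2 * (p.1 : ℤ) else if p.1 = p.2 then (p.1 : ℤ) + 1 else 0 := by
  rw [card_eq_sum_divisorsAntidiagonal m _ (fun d d' t => (d, d', 0, -t))
    (fun d d' => if d < d' then -d + 1 else if d = d' then 0 else d + 1) (fun d _ => d)]
  · refine Finset.sum_congr rfl fun p _ => ?_
    split_ifs <;> omega
  · intro d d' t h hd hd' h1 h2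
    simp only [Finset.mem_filter, mem_reducedQuadruples, IsReducedForm, and_true]
    split_ifs at h1 <;> exact ⟨by linarith, by omega⟩
  · intro d d' t k k' j _ _ _ _ _ _ _ _ h
    simp only [Prod.mk.injEq] at h
    omega
  · rintro ⟨a, c, x, y⟩ hq
    simp only [Finset.mem_filter, mem_reducedQuadruples, IsReducedForm] at hq
    obtain ⟨⟨h, ha, hr⟩, rfl⟩ := hq
    exact ⟨a, c, -y, by linarith, ha, by omega, by split_ifs <;> omega, by omega, by simp⟩

theorem card_filter_reducedQuadruples_eq_zero_and (m : ℕ) :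
    (Finset.card {q ∈ reducedQuadruples m | q.2.2.1 = 0 ∧ q.2.2.2 = 0} : ℤ) =
      ∑ p ∈ m.divisorsAntidiagonal, if p.1 ≤ p.2 then 1 else 0 := by
  rw [card_eq_sum_divisorsAntidiagonal m _ (fun d d' _ => (d, d', 0, 0)) (fun _ _ => 1)
    (fun d d' => if d ≤ d' then 1 else 0)]
  · refine Finset.sum_congr rfl fun p _ => ?_
    split_ifs <;> omega
  · intro d d' t h hd hd' h1 h2
    simp only [Finset.mem_filter, mem_reducedQuadruples, IsReducedForm, and_true]
    split_ifs at h2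
    · exact ⟨by linarith, by omega⟩
    · omega
  · intro d d' t k k' j _ _ _ _ _ _ _ _ h
    simp only [Prod.mk.injEq] at h
    split_ifs at * <;> omega
  · rintro ⟨a, c, x, y⟩ hq
    simp only [Finset.mem_filter, mem_reducedQuadruples, IsReducedForm] at hq
    obtain ⟨⟨h, ha, hr⟩, rfl, rfl⟩ := hq
    exact ⟨a, c, 1, by linarith, ha, by omega, le_rfl, by split_ifs <;> omega, rfl⟩

theorem card_filter_eq_and_eq_zero (m : ℕ) :
    Finset.card {q ∈ reducedQuadruples m | q.1 = q.2.1 ∧ q.2.2.1 = 0 ∧ q.2.2.2 = 0} =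
      Finset.card {p ∈ m.divisorsAntidiagonal | p.1 = p.2} := by
  zify
  rw [card_eq_sum_divisorsAntidiagonal m _ (fun d d' _ => (d, d', 0, 0)) (fun _ _ => 1)
    (fun d d' => if d = d' then 1 else 0), Finset.natCast_card_filter]
  · refine Finset.sum_congr rfl fun p _ => ?_
    split_ifs <;> omega
  · intro d d' t h hd hd' h1 h2
    simp only [Finset.mem_filter, mem_reducedQuadruples, IsReducedForm, and_true]
    split_ifs at h2
    · exact ⟨⟨by linarith, by omega⟩, by omega⟩
    · omega
  · intro d d' t k k' j _ _ _ _ _ _ _ _ h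
    simp only [Prod.mk.injEq] at h
    split_ifs at * <;> omega
  · rintro ⟨a, c, x, y⟩ hq
    simp only [Finset.mem_filter, mem_reducedQuadruples, IsReducedForm] at hq
    obtain ⟨⟨h, ha, hr⟩, rfl, rfl, rfl⟩ := hq
    exact ⟨a, a, 1, by linarith, ha, by omega, le_rfl, by simp, rfl⟩

theorem card_add_card_add_card_reducedQuadruples (m : ℕ) (δ : ℤ) (h0 : 0 ≤ δ) (h1 : δ ≤ 1) :
    (Finset.card {q ∈ reducedQuadruples m | 0 < q.2.2.1 ∧ 0 < q.2.2.2 ∧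
        q.2.2.2 + δ ≤ q.2.2.1 ∧ q.2.2.1 < q.2.2.2 + q.1 + δ ∧ q.1 < q.2.1 + δ} : ℤ)
      + Finset.card {q ∈ reducedQuadruples m | 0 < q.2.2.1 ∧ q.2.2.2 < 0 ∧
        q.2.2.1 - q.2.2.2 + δ ≤ q.1 ∧ q.1 < q.2.1 + δ}
      + Finset.card {q ∈ reducedQuadruples m | q.2.2.1 < 0 ∧ q.2.2.2 < 0 ∧
        q.2.2.2 + 1 - δ ≤ q.2.2.1 ∧ q.2.2.1 - q.2.2.2 + δ ≤ q.1 ∧ q.1 < q.2.1 + δ} =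
    ∑ p ∈ m.divisorsAntidiagonal,
      ((if (p.1 : ℤ) + δ ≤ p.2 then (p.2 : ℤ) - 1 else 0) - min ((p.1 : ℤ) - δ) (p.2 - 1)) := by
  rw [Finset.sum_sub_distrib, ← card_filter_positiveQuadruples_snd_eq m δ h0,
    ← card_filter_positiveQuadruples_fst_eq m δ h0 h1,
    ← card_add_card_add_card_positiveQuadruples m δ h0 h1]
  refine congrArg₂ (· + ·) (congrArg₂ (· + ·) (congrArg Nat.cast ?_) (congrArg Nat.cast ?_))
    (congrArg Nat.cast ?_)
  · congr 1
    ext ⟨a, c, x, y⟩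
    simp only [Finset.mem_filter, mem_positiveQuadruples, mem_reducedQuadruples, IsReducedForm]
    constructor <;> rintro ⟨⟨h, h'⟩, h''⟩ <;> exact ⟨⟨h, by omega⟩, by omega⟩
  · refine Finset.card_nbij' (fun q => (q.1 - q.2.2.1, q.2.1, q.2.2.1, q.2.2.2 + q.2.1))
      (fun q => (q.1 + q.2.2.1, q.2.1, q.2.2.1, q.2.2.2 - q.2.1)) ?_ ?_ ?_ ?_
    · rintro ⟨a, c, x, y⟩ hq
      simp only [Finset.mem_filter, Finset.mem_coe, mem_positiveQuadruples,
        mem_reducedQuadruples, IsReducedForm] at hq ⊢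
      exact ⟨⟨by linarith, by omega⟩, by omega⟩
    · rintro ⟨a, c, x, y⟩ hq
      simp only [Finset.mem_filter, Finset.mem_coe, mem_positiveQuadruples,
        mem_reducedQuadruples, IsReducedForm] at hq ⊢
      exact ⟨⟨by linarith, by omega⟩, by omega⟩
    · intro q _
      simp
    · intro q _
      simp
  · refine Finset.card_nbij' (fun q => (-q.2.2.1, -q.2.2.2, q.1, q.2.1))
      (fun q => (q.2.2.1, q.2.2.2, -q.1, -q.2.1)) ?_ ?_ ?_ ?_
    · rintro ⟨a, c, x, y⟩ hq
      simp only [Finset.mem_filter, Finset.mem_coe, mem_positiveQuadruples,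
        mem_reducedQuadruples, IsReducedForm] at hq ⊢
      exact ⟨⟨by linarith, by omega⟩, by omega⟩
    · rintro ⟨a, c, x, y⟩ hq
      simp only [Finset.mem_filter, Finset.mem_coe, mem_positiveQuadruples,
        mem_reducedQuadruples, IsReducedForm] at hq ⊢
      exact ⟨⟨by linarith, by omega⟩, by omega⟩
    · intro q _
      simp
    · intro q _
      simp

/-- Exchanging `x` and `y` negates the middle coefficient of the form. -/
theorem card_filter_lt_eq_card_filter_gt (m : ℕ) :
    Finset.card {q ∈ reducedQuadruples m | (q.2.2.1 ≠ 0 ∧ q.2.2.2 ≠ 0) ∧ q.2.2.1 < q.2.2.2} =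
      Finset.card {q ∈ reducedQuadruples m | (q.2.2.1 ≠ 0 ∧ q.2.2.2 ≠ 0) ∧
        q.2.2.2 < q.2.2.1 ∧ q.2.2.1 - q.2.2.2 < q.1 ∧ q.1 < q.2.1} := by
  refine Finset.card_nbij' (fun q => (q.1, q.2.1, q.2.2.2, q.2.2.1))
    (fun q => (q.1, q.2.1, q.2.2.2, q.2.2.1)) ?_ ?_ (fun _ _ => rfl) (fun _ _ => rfl)
  all_goals
    rintro ⟨a, c, x, y⟩ hq
    simp only [Finset.mem_filter, Finset.mem_coe, mem_reducedQuadruples, IsReducedForm] at hq ⊢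
    exact ⟨⟨by linarith, by omega⟩, by omega⟩

theorem card_reducedQuadruples_filter_ne_zero (m : ℕ) :
    (Finset.card {q ∈ reducedQuadruples m | q.2.2.1 ≠ 0 ∧ q.2.2.2 ≠ 0} : ℤ) =
      ∑ p ∈ m.divisorsAntidiagonal,
        ((if (p.1 : ℤ) ≤ p.2 then (p.2 : ℤ) - 1 else 0) - min (p.1 : ℤ) (p.2 - 1)
          + (if (p.1 : ℤ) + 1 ≤ p.2 then (p.2 : ℤ) - 1 else 0) - min ((p.1 : ℤ) - 1) (p.2 - 1))
      + Finset.card {q ∈ reducedQuadruples m |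
          q.1 = q.2.1 ∧ q.2.2.1 = q.2.2.2 ∧ 0 < q.2.2.1}
      + Finset.card {q ∈ reducedQuadruples m |
          q.1 = q.2.1 ∧ q.2.2.1 = q.2.2.2 + q.1 ∧ q.2.2.2 < 0 ∧ q.2.2.1 ≠ 0} := by
  have e0 := card_add_card_add_card_reducedQuadruples m 0 le_rfl zero_le_one
  have e1 := card_add_card_add_card_reducedQuadruples m 1 zero_le_one le_rfl
  have e2 : (Finset.card {q ∈ reducedQuadruples m |
      (q.2.2.1 ≠ 0 ∧ q.2.2.2 ≠ 0) ∧ q.2.2.1 < q.2.2.2} : ℤ) = _ :=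
    congrArg Nat.cast (card_filter_lt_eq_card_filter_gt m)
  simp only [add_zero, sub_zero] at e0
  have e3 : (Finset.card {q ∈ reducedQuadruples m | q.2.2.1 ≠ 0 ∧ q.2.2.2 ≠ 0} : ℤ)
      + Finset.card {q ∈ reducedQuadruples m | (q.2.2.1 ≠ 0 ∧ q.2.2.2 ≠ 0) ∧
        q.2.2.2 < q.2.2.1 ∧ q.2.2.1 - q.2.2.2 < q.1 ∧ q.1 < q.2.1} =
      (Finset.card {q ∈ reducedQuadruples m | 0 < q.2.2.1 ∧ 0 < q.2.2.2 ∧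
          q.2.2.2 ≤ q.2.2.1 ∧ q.2.2.1 < q.2.2.2 + q.1 ∧ q.1 < q.2.1}
        + Finset.card {q ∈ reducedQuadruples m | 0 < q.2.2.1 ∧ q.2.2.2 < 0 ∧
          q.2.2.1 - q.2.2.2 ≤ q.1 ∧ q.1 < q.2.1}
        + Finset.card {q ∈ reducedQuadruples m | q.2.2.1 < 0 ∧ q.2.2.2 < 0 ∧
          q.2.2.2 + 1 ≤ q.2.2.1 ∧ q.2.2.1 - q.2.2.2 ≤ q.1 ∧ q.1 < q.2.1})
      + (Finset.card {q ∈ reducedQuadruples m | 0 < q.2.2.1 ∧ 0 < q.2.2.2 ∧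
          q.2.2.2 + 1 ≤ q.2.2.1 ∧ q.2.2.1 < q.2.2.2 + q.1 + 1 ∧ q.1 < q.2.1 + 1}
        + Finset.card {q ∈ reducedQuadruples m | 0 < q.2.2.1 ∧ q.2.2.2 < 0 ∧
          q.2.2.1 - q.2.2.2 + 1 ≤ q.1 ∧ q.1 < q.2.1 + 1}
        + Finset.card {q ∈ reducedQuadruples m | q.2.2.1 < 0 ∧ q.2.2.2 < 0 ∧
          q.2.2.2 + 1 - 1 ≤ q.2.2.1 ∧ q.2.2.1 - q.2.2.2 + 1 ≤ q.1 ∧ q.1 < q.2.1 + 1})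
      + Finset.card {q ∈ reducedQuadruples m |
          q.1 = q.2.1 ∧ q.2.2.1 = q.2.2.2 ∧ 0 < q.2.2.1}
      + Finset.card {q ∈ reducedQuadruples m |
          q.1 = q.2.1 ∧ q.2.2.1 = q.2.2.2 + q.1 ∧ q.2.2.2 < 0 ∧ q.2.2.1 ≠ 0}
      + Finset.card {q ∈ reducedQuadruples m |
          (q.2.2.1 ≠ 0 ∧ q.2.2.2 ≠ 0) ∧ q.2.2.1 < q.2.2.2} := by
    simp only [Finset.natCast_card_filter, ← Finset.sum_add_distrib]
    refine Finset.sum_congr rfl ?_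
    rintro ⟨a, c, x, y⟩ hq
    obtain ⟨-, h⟩ := mem_reducedQuadruples.1 hq
    simp only [IsReducedForm] at h
    clear e0 e1 e2 hq
    dsimp only
    rcases eq_or_ne x 0 with rfl | hx0
    · simp
    rcases eq_or_ne y 0 with rfl | hy0
    · simp [hx0]
    rcases hx0.lt_or_gt with hx | hx <;> rcases hy0.lt_or_gt with hy | hy <;>
      simp only [hx, hy, hx0, hy0, hx.not_gt, hy.not_gt, true_and, false_and, and_true, and_false,
        if_false, ne_eq, not_false_eq_true] <;>
      split_ifs <;> omega
  rw [e0, e1, e2, ← Finset.sum_add_distrib] at e3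
  simp only [add_sub_assoc] at e3 ⊢
  simp only [add_assoc] at e3 ⊢
  linarith

theorem card_filter_fst_eq_snd_and_eq (m : ℕ) :
    Finset.card {q ∈ reducedQuadruples m | q.1 = q.2.1 ∧ q.2.2.1 = q.2.2.2} =
      2 * Finset.card {q ∈ reducedQuadruples m |
          q.1 = q.2.1 ∧ q.2.2.1 = q.2.2.2 ∧ 0 < q.2.2.1}
      + Finset.card {p ∈ m.divisorsAntidiagonal | p.1 = p.2} := by
  have hneg : Finset.card {q ∈ reducedQuadruples m |
        q.1 = q.2.1 ∧ q.2.2.1 = q.2.2.2 ∧ q.2.2.1 < 0} =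
      Finset.card {q ∈ reducedQuadruples m |
        q.1 = q.2.1 ∧ q.2.2.1 = q.2.2.2 ∧ 0 < q.2.2.1} := by
    refine Finset.card_nbij' (fun q => (q.1, q.2.1, -q.2.2.1, -q.2.2.2))
      (fun q => (q.1, q.2.1, -q.2.2.1, -q.2.2.2)) ?_ ?_ (fun _ _ => by simp) (fun _ _ => by simp)
    all_goals
      rintro ⟨a, c, x, y⟩ hq
      simp only [Finset.mem_filter, Finset.mem_coe, mem_reducedQuadruples, IsReducedForm] at hq ⊢
      exact ⟨⟨by linarith, by omega⟩, by omega⟩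
  rw [two_mul, ← card_filter_eq_and_eq_zero]
  nth_rewrite 1 [← hneg]
  simp only [Finset.card_filter, ← Finset.sum_add_distrib]
  refine Finset.sum_congr rfl fun q _ => ?_
  split_ifs <;> omega

theorem card_filter_fst_eq_snd_and_eq_add (m : ℕ) :
    2 * Finset.card {q ∈ reducedQuadruples m | q.1 = q.2.1 ∧ q.2.2.1 = q.2.2.2 + q.1} =
      3 * Finset.card {q ∈ reducedQuadruples m |
          q.1 = q.2.1 ∧ q.2.2.1 = q.2.2.2 + q.1 ∧ q.2.2.2 < 0 ∧ q.2.2.1 ≠ 0}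
      + 4 * Finset.card {p ∈ m.divisorsAntidiagonal | p.1 = p.2} := by
  have hx : Finset.card {q ∈ reducedQuadruples m |
        q.1 = q.2.1 ∧ q.2.2.1 = q.2.2.2 + q.1 ∧ q.2.2.1 < 0} =
      Finset.card {q ∈ reducedQuadruples m |
        q.1 = q.2.1 ∧ q.2.2.1 = q.2.2.2 + q.1 ∧ 0 < q.2.2.2} := by
    refine Finset.card_nbij' (fun q => (q.1, q.2.1, -q.2.2.2, -q.2.2.1))
      (fun q => (q.1, q.2.1, -q.2.2.2, -q.2.2.1)) ?_ ?_ (fun _ _ => by simp) (fun _ _ => by simp)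
    all_goals
      rintro ⟨a, c, x, y⟩ hq
      simp only [Finset.mem_filter, Finset.mem_coe, mem_reducedQuadruples, IsReducedForm] at hq ⊢
      exact ⟨⟨by linarith, by omega⟩, by omega⟩
  have hy : Finset.card {q ∈ reducedQuadruples m |
        q.1 = q.2.1 ∧ q.2.2.1 = q.2.2.2 + q.1 ∧ q.2.2.2 < 0 ∧ 0 < q.2.2.1} =
      Finset.card {q ∈ reducedQuadruples m |
        q.1 = q.2.1 ∧ q.2.2.1 = q.2.2.2 + q.1 ∧ 0 < q.2.2.2} := by
    refine Finset.card_nbij' (fun q => (q.2.2.1, q.2.2.1, q.1, -q.2.2.2))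
      (fun q => (q.2.2.1, q.2.2.1, q.1, -q.2.2.2)) ?_ ?_ ?_ ?_
    · rintro ⟨a, c, x, y⟩ hq
      simp only [Finset.mem_filter, Finset.mem_coe, mem_reducedQuadruples, IsReducedForm,
        true_and, and_true] at hq ⊢
      obtain ⟨⟨h, hr⟩, rfl, rfl, hq⟩ := hq
      exact ⟨⟨by linarith, by omega⟩, by omega⟩
    · rintro ⟨a, c, x, y⟩ hq
      simp only [Finset.mem_filter, Finset.mem_coe, mem_reducedQuadruples, IsReducedForm,
        true_and, and_true] at hq ⊢
      obtain ⟨⟨h, hr⟩, rfl, rfl, hq⟩ := hq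
      exact ⟨⟨by linarith, by omega⟩, by omega⟩
    all_goals
      rintro ⟨a, c, x, y⟩ hq
      simp only [Finset.mem_filter, Finset.mem_coe] at hq
      simp [hq.2.1]
  have hzero : Finset.card {q ∈ reducedQuadruples m |
        q.1 = q.2.1 ∧ q.2.2.1 = q.2.2.2 + q.1 ∧ q.2.2.2 = 0} =
      Finset.card {q ∈ reducedQuadruples m | q.1 = q.2.1 ∧ q.2.2.1 = 0 ∧ q.2.2.2 = 0} := by
    refine Finset.card_nbij' (fun q => (q.1, q.2.1, 0, 0)) (fun q => (q.1, q.2.1, q.1, 0))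
      ?_ ?_ ?_ ?_
    · rintro ⟨a, c, x, y⟩ hq
      simp only [Finset.mem_filter, Finset.mem_coe, mem_reducedQuadruples, IsReducedForm] at hq ⊢
      obtain ⟨⟨h, hr⟩, rfl, rfl, rfl⟩ := hq
      exact ⟨⟨by linarith, by omega⟩, by simp⟩
    · rintro ⟨a, c, x, y⟩ hq
      simp only [Finset.mem_filter, Finset.mem_coe, mem_reducedQuadruples, IsReducedForm] at hq ⊢
      obtain ⟨⟨h, hr⟩, rfl, rfl, rfl⟩ := hq
      exact ⟨⟨by linarith, by omega⟩, by simp⟩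
    all_goals
      rintro ⟨a, c, x, y⟩ hq
      simp only [Finset.mem_filter, Finset.mem_coe] at hq
      simp [hq.2]
  have hzero' : Finset.card {q ∈ reducedQuadruples m |
        q.1 = q.2.1 ∧ q.2.2.1 = q.2.2.2 + q.1 ∧ q.2.2.1 = 0} =
      Finset.card {q ∈ reducedQuadruples m |
        q.1 = q.2.1 ∧ q.2.2.1 = q.2.2.2 + q.1 ∧ q.2.2.2 = 0} := by
    refine Finset.card_nbij' (fun q => (q.1, q.2.1, -q.2.2.2, -q.2.2.1))
      (fun q => (q.1, q.2.1, -q.2.2.2, -q.2.2.1)) ?_ ?_ (fun _ _ => by simp) (fun _ _ => by simp)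
    all_goals
      rintro ⟨a, c, x, y⟩ hq
      simp only [Finset.mem_filter, Finset.mem_coe, mem_reducedQuadruples, IsReducedForm] at hq ⊢
      exact ⟨⟨by linarith, by omega⟩, by omega⟩
  have hne : Finset.card {q ∈ reducedQuadruples m |
        q.1 = q.2.1 ∧ q.2.2.1 = q.2.2.2 + q.1 ∧ q.2.2.2 < 0 ∧ q.2.2.1 ≠ 0} =
      Finset.card {q ∈ reducedQuadruples m |
        q.1 = q.2.1 ∧ q.2.2.1 = q.2.2.2 + q.1 ∧ q.2.2.2 < 0 ∧ 0 < q.2.2.1} +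
      Finset.card {q ∈ reducedQuadruples m |
        q.1 = q.2.1 ∧ q.2.2.1 = q.2.2.2 + q.1 ∧ q.2.2.1 < 0} := by
    simp only [Finset.card_filter, ← Finset.sum_add_distrib]
    refine Finset.sum_congr rfl ?_
    rintro ⟨a, c, x, y⟩ hq
    have := (mem_reducedQuadruples.1 hq).2.1
    split_ifs <;> omega
  have hall : Finset.card {q ∈ reducedQuadruples m | q.1 = q.2.1 ∧ q.2.2.1 = q.2.2.2 + q.1} =
      Finset.card {q ∈ reducedQuadruples m |
        q.1 = q.2.1 ∧ q.2.2.1 = q.2.2.2 + q.1 ∧ q.2.2.2 < 0 ∧ q.2.2.1 ≠ 0} +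
      Finset.card {q ∈ reducedQuadruples m |
        q.1 = q.2.1 ∧ q.2.2.1 = q.2.2.2 + q.1 ∧ q.2.2.1 = 0} +
      Finset.card {q ∈ reducedQuadruples m |
        q.1 = q.2.1 ∧ q.2.2.1 = q.2.2.2 + q.1 ∧ q.2.2.2 = 0} +
      Finset.card {q ∈ reducedQuadruples m |
        q.1 = q.2.1 ∧ q.2.2.1 = q.2.2.2 + q.1 ∧ 0 < q.2.2.2} := by
    simp only [Finset.card_filter, ← Finset.sum_add_distrib]
    refine Finset.sum_congr rfl ?_
    rintro ⟨a, c, x, y⟩ hq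
    have := (mem_reducedQuadruples.1 hq).2.1
    split_ifs <;> omega
  rw [← card_filter_eq_and_eq_zero]
  omega

theorem card_reducedQuadruples (m : ℕ) :
    (Finset.card (reducedQuadruples m) : ℤ) = ∑ p ∈ m.divisorsAntidiagonal, max (p.1 : ℤ) p.2
      + 2 * Finset.card {p ∈ m.divisorsAntidiagonal | p.1 = p.2}
      + Finset.card {q ∈ reducedQuadruples m |
          q.1 = q.2.1 ∧ q.2.2.1 = q.2.2.2 ∧ 0 < q.2.2.1}
      + Finset.card {q ∈ reducedQuadruples m |
          q.1 = q.2.1 ∧ q.2.2.1 = q.2.2.2 + q.1 ∧ q.2.2.2 < 0 ∧ q.2.2.1 ≠ 0} := by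
  have hcard : (Finset.card (reducedQuadruples m) : ℤ) =
      Finset.card {q ∈ reducedQuadruples m | q.2.2.1 ≠ 0 ∧ q.2.2.2 ≠ 0}
      + Finset.card {q ∈ reducedQuadruples m | q.2.2.1 = 0}
      + Finset.card {q ∈ reducedQuadruples m | q.2.2.2 = 0}
      - Finset.card {q ∈ reducedQuadruples m | q.2.2.1 = 0 ∧ q.2.2.2 = 0} := by
    rw [Finset.card_eq_sum_ones, Nat.cast_sum]
    simp only [Finset.natCast_card_filter, Nat.cast_one, ← Finset.sum_add_distrib,
      ← Finset.sum_sub_distrib]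
    refine Finset.sum_congr rfl fun q _ => ?_
    split_ifs <;> omega
  rw [hcard, card_reducedQuadruples_filter_ne_zero, card_filter_reducedQuadruples_fst_eq_zero,
    card_filter_reducedQuadruples_snd_eq_zero, card_filter_reducedQuadruples_eq_zero_and,
    Finset.natCast_card_filter (fun p : ℕ × ℕ => p.1 = p.2)]
  set g : ℕ × ℕ → ℤ := fun p =>
    ((if (p.1 : ℤ) ≤ p.2 then (p.2 : ℤ) - 1 else 0) - min (p.1 : ℤ) (p.2 - 1)
          + (if (p.1 : ℤ) + 1 ≤ p.2 then (p.2 : ℤ) - 1 else 0) - min ((p.1 : ℤ) - 1) (p.2 - 1))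
    + 2 * (if p.1 < p.2 then 2 * (p.1 : ℤ) else if p.1 = p.2 then (p.1 : ℤ) + 1 else 0)
    - (if p.1 ≤ p.2 then 1 else 0) - max (p.1 : ℤ) p.2 - 2 * (if p.1 = p.2 then 1 else 0) with hg
  have hswap : ∑ p ∈ m.divisorsAntidiagonal, g p = ∑ p ∈ m.divisorsAntidiagonal, g p.swap := by
    conv_lhs => rw [← Nat.map_swap_divisorsAntidiagonal, Finset.sum_map]
    rfl
  have hg' (i j : ℕ) (hi : 0 < i) (hij : i ≤ j) : g (i, j) + g (j, i) = 0 := by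
    rcases hij.lt_or_eq with h | rfl
    · have h1 : (i : ℤ) + 1 ≤ j := by exact_mod_cast h
      have h2 : ¬(j : ℤ) + 1 ≤ i := by omega
      simp only [hg, h, h1, h2, h.ne, h.ne', h.not_gt, h.not_ge, hij, Nat.cast_le, if_true,
        if_false]
      omega
    · simp only [hg, lt_irrefl, le_refl, Int.not_le.2 (Int.lt_succ (i : ℤ)), if_true, if_false]
      omega
  have hg0 : ∑ p ∈ m.divisorsAntidiagonal, (g p + g p.swap) = 0 := by
    refine Finset.sum_eq_zero fun p hp => ?_
    have h1 := Nat.pos_of_mem_divisors (Nat.fst_mem_divisors_of_mem_antidiagonal hp)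
    have h2 := Nat.pos_of_mem_divisors (Nat.snd_mem_divisors_of_mem_antidiagonal hp)
    rcases le_total p.1 p.2 with h | h
    · exact hg' _ _ h1 h
    · rw [add_comm]
      exact hg' _ _ h2 h
  have hsum : ∑ p ∈ m.divisorsAntidiagonal, g p = 0 := by
    rw [Finset.sum_add_distrib, ← hswap] at hg0
    omega
  simp only [hg, Finset.sum_sub_distrib, Finset.sum_add_distrib, ← Finset.mul_sum] at hsum ⊢
  linarith

theorem sum_divisorsAntidiagonal_max (m : ℕ) :
    ∑ p ∈ m.divisorsAntidiagonal, (max p.1 p.2 : ℝ) =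
      2 * ∑ d ∈ m.divisors, (d : ℝ) - ∑ p ∈ m.divisorsAntidiagonal, ((min p.1 p.2 : ℕ) : ℝ) := by
  rw [eq_sub_iff_add_eq, two_mul, ← Finset.sum_add_distrib]
  nth_rewrite 1 [← Nat.sum_divisorsAntidiagonal fun i _ => (i : ℝ)]
  rw [← Nat.sum_divisorsAntidiagonal' fun _ j => (j : ℝ), ← Finset.sum_add_distrib]
  refine Finset.sum_congr rfl fun p _ => ?_
  rw [Nat.cast_min, max_add_min]

theorem statement5 (m : ℕ) (hm : 0 < m) :
    {r : ℤ | hurwitzH (4 * (m : ℤ) - r ^ 2) ≠ 0}.Finite ∧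
    ∑ᶠ r : ℤ, hurwitzH (4 * (m : ℤ) - r ^ 2)
      = 2 * (∑ d ∈ m.divisors, (d : ℝ))
        - ∑ᶠ p ∈ {p : ℕ × ℕ | p.1 * p.2 = m}, ((min p.1 p.2 : ℕ) : ℝ) := by
  obtain ⟨hfin, hsum⟩ := finsum_hurwitzH m hm
  refine ⟨hfin, ?_⟩
  have hdiv : {p : ℕ × ℕ | p.1 * p.2 = m} = (m.divisorsAntidiagonal : Set (ℕ × ℕ)) := by
    ext p
    simp [hm.ne']
  rw [hsum, hdiv, finsum_mem_coe_finset, ← sum_divisorsAntidiagonal_max]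
  have h1 := congrArg (Int.cast : ℤ → ℝ) (card_reducedQuadruples m)
  have h2 := congrArg (Nat.cast : ℕ → ℝ) (card_filter_fst_eq_snd_and_eq m)
  have h3 := congrArg (Nat.cast : ℕ → ℝ) (card_filter_fst_eq_snd_and_eq_add m)
  push_cast at h1 h2 h3
  linarith
end
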